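/- arXiv:0807.1081 — 2 statements merged into one kernel-verified Lean document; each statement's English description precedes it below -/
import Mathlib

section
/- Each Jacobi theta-null satisfies Jacobi's nonlinear third-order differential equation: for ϑ equal to any one of θ₂, θ₃, θ₄ and all τ in the upper half-plane, (ϑ²ϑ′′′ − 15ϑϑ′ϑ′′ + 30ϑ′³)² + 32(ϑϑ′′ − 3ϑ′²)³ = ϑ^{10}·(ϑϑ′′ − 3ϑ′²)². -/
open Complex

noncomputable section

/-- The Jacobi theta-null θ₂. -/
def theta2 (τ : ℂ) : ℂ :=
  ∑' m : ℤ, Complex.exp (2 * Real.pi * Complex.I * τ * ((m : ℂ) + 1 / 2) ^ 2)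

/-- The Jacobi theta-null θ₃. -/
def theta3 (τ : ℂ) : ℂ :=
  ∑' m : ℤ, Complex.exp (2 * Real.pi * Complex.I * τ * (m : ℂ) ^ 2)

/-- The Jacobi theta-null θ₄. -/
def theta4 (τ : ℂ) : ℂ :=
  ∑' m : ℤ, (-1 : ℂ) ^ m * Complex.exp (2 * Real.pi * Complex.I * τ * (m : ℂ) ^ 2)

/-- The derivation f ↦ f′ = (2πi)⁻¹ df/dτ = q d/dq. -/
def dq (f : ℂ → ℂ) : ℂ → ℂ := fun τ => (2 * Real.pi * Complex.I)⁻¹ * deriv f τ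

namespace JTO

open Filter Topology UpperHalfPlane ModularForm MatrixGroups

/-- The upper half-plane as a set. -/
def U : Set ℂ := {z | 0 < z.im}

/-- The filter of points with imaginary part going to infinity. -/
def L : Filter ℂ := comap Complex.im atTop

lemma isOpen_U : IsOpen U := isOpen_lt continuous_const Complex.continuous_im

lemma U_mem_L : U ∈ L := by
  refine mem_comap.mpr ⟨Set.Ioi 0, Ioi_mem_atTop 0, fun z hz => hz⟩

instance : L.NeBot := by
  refine comap_neBot_iff_frequently.mpr (Eventually.frequently ?_)
  filter_upwards with t using ⟨Complex.I * t, by simp⟩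

lemma ne_zero_of_U {τ : ℂ} (h : τ ∈ U) : τ ≠ 0 := by
  rintro rfl
  simp [U] at h

lemma U_add {τ : ℂ} (h : τ ∈ U) : τ + 1 ∈ U := by
  simpa [U] using h

lemma U_inv {τ : ℂ} (h : τ ∈ U) : -1 / τ ∈ U := by
  have h' : 0 < τ.im := h
  show 0 < (-1 / τ).im
  rw [div_eq_mul_inv, neg_one_mul, Complex.neg_im, Complex.inv_im, neg_div, neg_neg]
  exact div_pos h' (Complex.normSq_pos.mpr (ne_zero_of_U h))

/-- Build a level one cusp form from elementary data. -/
lemma exists_cuspForm (f : ℂ → ℂ) (k : ℤ) (hd : DifferentiableOn ℂ f U)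
    (hT : ∀ τ ∈ U, f (τ + 1) = f τ) (hS : ∀ τ ∈ U, f (-1 / τ) = τ ^ k * f τ)
    (h0 : Tendsto f L (𝓝 0)) :
    ∃ F : CuspForm 𝒮ℒ k, ∀ z : ℍ, F z = f z := by
  let g : ℍ → ℂ := fun z => f z
  have gS : g ∣[k] ModularGroup.S = g := by
    ext z
    rw [SL_slash_apply, UpperHalfPlane.modular_S_smul]
    have h1 := hS z z.2
    have h2 : denom (ModularGroup.S : GL (Fin 2) ℝ) z = z := by
      exact ModularGroup.denom_S z
    have hz : (z : ℂ) ^ k ≠ 0 := zpow_ne_zero _ z.ne_zero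
    show f _ * _ = f z
    have h3 : ((UpperHalfPlane.mk (-(z : ℂ))⁻¹ z.im_inv_neg_coe_pos : ℍ) : ℂ) = -1 / z := by
      show (-(z : ℂ))⁻¹ = _
      rw [inv_neg, neg_div, one_div]
    rw [h3, h1]
    erw [h2]
    rw [zpow_neg]
    field_simp
  have gT : g ∣[k] ModularGroup.T = g := by
    ext z
    rw [SL_slash_apply, UpperHalfPlane.modular_T_smul]
    have h1 := hT z z.2
    have h2 : denom (ModularGroup.T : GL (Fin 2) ℝ) z = 1 := by
      have := ModularGroup.denom_apply ModularGroup.T z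
      simpa [ModularGroup.T] using this
    erw [h2]
    show f _ * _ = f z
    have h3 : (((1 : ℝ) +ᵥ z : ℍ) : ℂ) = z + 1 := by
      rw [UpperHalfPlane.coe_vadd]; push_cast; ring
    rw [h3, h1]; simp
  have gz : IsZeroAtImInfty g := by
    refine h0.comp ?_
    exact tendsto_comap_iff.mpr tendsto_comap
  refine ⟨{ toFun := g, slash_action_eq' := ?_, holo' := ?_, zero_at_cusps' := ?_ }, fun z => rfl⟩
  · intro A hA
    obtain ⟨A, rfl⟩ := hA
    exact SlashInvariantForm.slash_action_generators_SL2Z gS gT A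
  · rw [UpperHalfPlane.mdifferentiable_iff]
    refine hd.congr fun z hz ↦ ?_
    show f _ = _
    rw [ofComplex_apply_of_im_pos hz]
  · intro c hc
    rw [OnePoint.isZeroAt_iff_forall_SL2Z hc]
    intro γ _
    rw [SlashInvariantForm.slash_action_generators_SL2Z gS gT]
    exact gz

lemma cusp_zero (f : ℂ → ℂ) (k : ℤ) (hk : k < 12) (hd : DifferentiableOn ℂ f U)
    (hT : ∀ τ ∈ U, f (τ + 1) = f τ) (hS : ∀ τ ∈ U, f (-1 / τ) = τ ^ k * f τ)
    (h0 : Tendsto f L (𝓝 0)) : ∀ τ ∈ U, f τ = 0 := by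
  obtain ⟨F, hF⟩ := exists_cuspForm f k hd hT hS h0
  intro τ hτ
  have h := rank_zero_iff_forall_zero.mp (CuspForm.rank_eq_zero_of_weight_lt_twelve hk) F
  have := hF ⟨τ, hτ⟩
  rw [h] at this
  exact this.symm

lemma cusp_twelve (f : ℂ → ℂ) (hd : DifferentiableOn ℂ f U)
    (hT : ∀ τ ∈ U, f (τ + 1) = f τ) (hS : ∀ τ ∈ U, f (-1 / τ) = τ ^ (12 : ℤ) * f τ)
    (h0 : Tendsto f L (𝓝 0)) (hne : ∃ τ ∈ U, f τ ≠ 0) : ∀ τ ∈ U, f τ ≠ 0 := by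
  obtain ⟨F, hF⟩ := exists_cuspForm f 12 hd hT hS h0
  obtain ⟨c, hc⟩ := CuspForm.exists_smul_discriminant_of_weight_eq_twelve F
  have key : ∀ z : ℍ, f z = c * ModularForm.discriminant z := by
    intro z
    rw [← hF, ← hc]; rfl
  obtain ⟨σ, hσ, hσ'⟩ := hne
  have hc0 : c ≠ 0 := by
    rintro rfl
    apply hσ'
    simpa using key ⟨σ, hσ⟩
  intro τ hτ
  have := key ⟨τ, hτ⟩
  show f τ ≠ 0
  simp only at this
  rw [this]
  exact mul_ne_zero hc0 (discriminant_ne_zero _)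

/-- Derivatives of functions with a limit at infinity tend to zero. -/
lemma tendsto_deriv_zero (f : ℂ → ℂ) (l : ℂ) (hd : DifferentiableOn ℂ f U)
    (h : Tendsto f L (𝓝 l)) : Tendsto (deriv f) L (𝓝 0) := by
  rw [Metric.tendsto_nhds] at h ⊢
  intro ε hε
  have h1 := h (ε / 2) (by positivity)
  simp only [L, eventually_comap, eventually_atTop] at h1 ⊢
  obtain ⟨A, hA⟩ := h1
  refine ⟨max A 0 + 2, fun y hy τ hτ => ?_⟩
  have him : ∀ z ∈ Metric.closedBall τ 1, max A 0 < z.im := by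
    intro z hz
    have := (Complex.abs_im_le_norm (z - τ)).trans (by simpa [dist_eq_norm] using hz)
    rw [Complex.sub_im, abs_le] at this
    linarith [this.1]
  have hd' : DiffContOnCl ℂ (fun z => f z - l) (Metric.ball τ 1) := by
    apply DifferentiableOn.diffContOnCl
    refine DifferentiableOn.sub_const ?_ l
    refine hd.mono fun z hz => ?_
    rw [closure_ball τ one_ne_zero] at hz
    exact lt_of_le_of_lt (le_max_right _ _) (him z hz)
  have := Complex.norm_deriv_le_of_forall_mem_sphere_norm_le (C := ε / 2) one_pos hd' (by
    intro z hz
    have hz' := him z (Metric.sphere_subset_closedBall hz)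
    have := hA z.im ((le_max_left _ _).trans hz'.le) z rfl
    rw [dist_eq_norm] at this
    exact this.le)
  rw [deriv_sub_const] at this
  rw [dist_zero_right]
  linarith

/-- The nome derivation. -/
noncomputable def DD (f : ℂ → ℂ) : ℂ → ℂ := fun τ => (Real.pi * Complex.I)⁻¹ * deriv f τ

lemma piI_ne : (Real.pi * Complex.I : ℂ) ≠ 0 := by
  simp [Real.pi_ne_zero]

lemma DD_eq {f : ℂ → ℂ} {d τ : ℂ} (h : HasDerivAt f (Real.pi * Complex.I * d) τ) : DD f τ = d := by
  unfold DD
  rw [h.deriv, inv_mul_cancel_left₀ piI_ne]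

lemma DD_has {f : ℂ → ℂ} {τ : ℂ} (hd : DifferentiableOn ℂ f U) (hτ : τ ∈ U) :
    HasDerivAt f (Real.pi * Complex.I * DD f τ) τ := by
  unfold DD
  rw [mul_inv_cancel_left₀ piI_ne]
  exact (hd.differentiableAt (isOpen_U.mem_nhds hτ)).hasDerivAt

lemma DD_diff {f : ℂ → ℂ} (hd : DifferentiableOn ℂ f U) : DifferentiableOn ℂ (DD f) U :=
  (hd.deriv isOpen_U).const_mul _

lemma DD_congr {f g : ℂ → ℂ} (h : ∀ τ ∈ U, f τ = g τ) {τ : ℂ} (hτ : τ ∈ U) :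
    DD f τ = DD g τ := by
  unfold DD
  congr 1
  exact Filter.EventuallyEq.deriv_eq (Filter.eventually_of_mem (isOpen_U.mem_nhds hτ) h)

lemma DD_tendsto {f : ℂ → ℂ} {l : ℂ} (hd : DifferentiableOn ℂ f U)
    (h : Tendsto f L (𝓝 l)) : Tendsto (DD f) L (𝓝 0) := by
  have := (tendsto_deriv_zero f l hd h).const_mul (Real.pi * Complex.I : ℂ)⁻¹
  rwa [mul_zero] at this

/-- A quarter of the logarithmic nome derivative. -/
def yy (f : ℂ → ℂ) : ℂ → ℂ := fun τ => DD f τ / (4 * f τ)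

lemma yy_diff {f : ℂ → ℂ} (hd : DifferentiableOn ℂ f U) (h0 : ∀ τ ∈ U, f τ ≠ 0) :
    DifferentiableOn ℂ (yy f) U :=
  (DD_diff hd).div (hd.const_mul 4) fun τ hτ => mul_ne_zero (by norm_num) (h0 τ hτ)

lemma DD_of_yy {f : ℂ → ℂ} (h0 : ∀ τ ∈ U, f τ ≠ 0) {τ : ℂ} (hτ : τ ∈ U) :
    DD f τ = 4 * yy f τ * f τ := by
  have := h0 τ hτ
  unfold yy
  field_simp

lemma DD_shift {f g : ℂ → ℂ} {e : ℂ} (hf : DifferentiableOn ℂ f U)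
    (hT : ∀ τ ∈ U, f (τ + 1) = e * g τ) (hg : DifferentiableOn ℂ g U) {τ : ℂ} (hτ : τ ∈ U) :
    DD f (τ + 1) = e * DD g τ := by
  have h1 : HasDerivAt (fun z => f (z + 1)) (Real.pi * Complex.I * DD f (τ + 1)) τ :=
    (DD_has hf (U_add hτ)).comp_add_const τ 1
  have h2 := DD_congr (f := fun z => f (z + 1)) (g := fun z => e * g z) hT hτ
  rw [DD_eq h1] at h2
  rw [h2]
  apply DD_eq
  exact ((DD_has hg hτ).const_mul e).congr_deriv (by ring)

lemma hasDeriv_inv {f : ℂ → ℂ} (hf : DifferentiableOn ℂ f U) {τ : ℂ} (hτ : τ ∈ U) :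
    HasDerivAt (fun z => f (-1 / z)) (Real.pi * Complex.I * (DD f (-1 / τ) / τ ^ 2)) τ := by
  have h1 : HasDerivAt (fun z : ℂ => -1 / z) (1 / τ ^ 2) τ := by
    have := (hasDerivAt_inv (ne_zero_of_U hτ)).neg
    refine (this.congr_deriv ?_).congr_of_eventuallyEq ?_
    · ring
    · filter_upwards with z
      simp [neg_div]
  have h2 := (DD_has hf (U_inv hτ)).comp τ h1
  exact h2.congr_deriv (by ring)

lemma yy_shift {f g : ℂ → ℂ} {e : ℂ} (he : e ≠ 0) (hf : DifferentiableOn ℂ f U)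
    (hg : DifferentiableOn ℂ g U)
    (hT : ∀ τ ∈ U, f (τ + 1) = e * g τ) {τ : ℂ} (hτ : τ ∈ U) :
    yy f (τ + 1) = yy g τ := by
  unfold yy
  rw [DD_shift hf hT hg hτ, hT τ hτ, mul_left_comm, mul_div_mul_left _ _ he]

lemma yy_inv {f g : ℂ → ℂ} (hf : DifferentiableOn ℂ f U) (hg : DifferentiableOn ℂ g U)
    (g0 : ∀ τ ∈ U, g τ ≠ 0)
    (hS : ∀ τ ∈ U, f (-1 / τ) = -τ ^ 2 * g τ) {τ : ℂ} (hτ : τ ∈ U) :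
    yy f (-1 / τ) = τ ^ 2 * yy g τ + τ / (2 * (Real.pi * Complex.I)) := by
  have hτ0 := ne_zero_of_U hτ
  have hp := piI_ne
  have h2 := DD_congr (f := fun z => f (-1 / z)) (g := fun z => -z ^ 2 * g z) hS hτ
  rw [DD_eq (hasDeriv_inv hf hτ)] at h2
  have h3 : HasDerivAt (fun z => -z ^ 2 * g z)
      (Real.pi * Complex.I * (-2 * τ * g τ / (Real.pi * Complex.I) - τ ^ 2 * DD g τ)) τ := by
    have h4 : HasDerivAt (fun z : ℂ => -z ^ 2) (-(2 * τ)) τ := by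
      exact ((hasDerivAt_pow 2 τ).neg).congr_deriv (by simp)
    refine (h4.mul (DD_has hg hτ)).congr_deriv ?_
    field_simp
    ring
  rw [DD_eq h3, div_eq_iff (pow_ne_zero 2 hτ0)] at h2
  have := g0 τ hτ
  unfold yy
  rw [h2, hS τ hτ]
  field_simp
  ring

/-- The Riccati expression. -/
def rr (f : ℂ → ℂ) : ℂ → ℂ := fun τ => DD (yy f) τ - 2 * yy f τ ^ 2

lemma rr_shift {f g : ℂ → ℂ} {e : ℂ} (he : e ≠ 0) (hf : DifferentiableOn ℂ f U)
    (hg : DifferentiableOn ℂ g U) (f0 : ∀ τ ∈ U, f τ ≠ 0) (g0 : ∀ τ ∈ U, g τ ≠ 0)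
    (hT : ∀ τ ∈ U, f (τ + 1) = e * g τ) {τ : ℂ} (hτ : τ ∈ U) :
    rr f (τ + 1) = rr g τ := by
  unfold rr
  rw [yy_shift he hf hg hT hτ, DD_shift (e := 1) (g := yy g) (yy_diff hf f0) ?_ (yy_diff hg g0) hτ]
  · ring
  · intro τ hτ
    rw [yy_shift he hf hg hT hτ, one_mul]

lemma rr_inv {f g : ℂ → ℂ} (hf : DifferentiableOn ℂ f U) (hg : DifferentiableOn ℂ g U)
    (f0 : ∀ τ ∈ U, f τ ≠ 0) (g0 : ∀ τ ∈ U, g τ ≠ 0)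
    (hS : ∀ τ ∈ U, f (-1 / τ) = -τ ^ 2 * g τ) {τ : ℂ} (hτ : τ ∈ U) :
    rr f (-1 / τ) = τ ^ 4 * rr g τ := by
  have hτ0 := ne_zero_of_U hτ
  have hp := piI_ne
  have h2 := DD_congr (f := fun z => yy f (-1 / z))
    (g := fun z => z ^ 2 * yy g z + z / (2 * (Real.pi * Complex.I)))
    (fun τ hτ => yy_inv hf hg g0 hS hτ) hτ
  rw [DD_eq (hasDeriv_inv (yy_diff hf f0) hτ)] at h2
  have h3 : HasDerivAt (fun z => z ^ 2 * yy g z + z / (2 * (Real.pi * Complex.I)))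
      (Real.pi * Complex.I * (2 * τ * yy g τ / (Real.pi * Complex.I) + τ ^ 2 * DD (yy g) τ
        + 1 / (2 * (Real.pi * Complex.I) ^ 2))) τ := by
    have h4 : HasDerivAt (fun z : ℂ => z ^ 2) (2 * τ) τ := by
      simpa using hasDerivAt_pow 2 τ
    refine ((h4.mul (DD_has (yy_diff hg g0) hτ)).add
      ((hasDerivAt_id τ).div_const (2 * (Real.pi * Complex.I)))).congr_deriv ?_
    field_simp
  rw [DD_eq h3, div_eq_iff (pow_ne_zero 2 hτ0)] at h2
  unfold rr
  rw [h2, yy_inv hf hg g0 hS hτ]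
  field_simp
  ring

/-- The properties of fourth powers of the theta-nulls that are used. -/
structure TD (a b c : ℂ → ℂ) : Prop where
  da : DifferentiableOn ℂ a U
  db : DifferentiableOn ℂ b U
  dc : DifferentiableOn ℂ c U
  a0 : ∀ τ ∈ U, a τ ≠ 0
  b0 : ∀ τ ∈ U, b τ ≠ 0
  c0 : ∀ τ ∈ U, c τ ≠ 0
  Ta : ∀ τ ∈ U, a (τ + 1) = -1 * a τ
  Tb : ∀ τ ∈ U, b (τ + 1) = 1 * c τ
  Tc : ∀ τ ∈ U, c (τ + 1) = 1 * b τ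
  Sa : ∀ τ ∈ U, a (-1 / τ) = -τ ^ 2 * c τ
  Sb : ∀ τ ∈ U, b (-1 / τ) = -τ ^ 2 * b τ
  Sc : ∀ τ ∈ U, c (-1 / τ) = -τ ^ 2 * a τ
  la : Tendsto a L (𝓝 0)
  lb : Tendsto b L (𝓝 1)
  lc : Tendsto c L (𝓝 1)
  lya : Tendsto (yy a) L (𝓝 (1 / 4))

namespace TD

variable {a b c : ℂ → ℂ}

lemma lyb (h : TD a b c) : Tendsto (yy b) L (𝓝 0) := by
  have := (DD_tendsto h.db h.lb).div (h.lb.const_mul 4) (by norm_num)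
  rw [zero_div] at this
  exact this

lemma lyc (h : TD a b c) : Tendsto (yy c) L (𝓝 0) := by
  have := (DD_tendsto h.dc h.lc).div (h.lc.const_mul 4) (by norm_num)
  rw [zero_div] at this
  exact this

lemma dya (h : TD a b c) : DifferentiableOn ℂ (yy a) U := yy_diff h.da h.a0
lemma dyb (h : TD a b c) : DifferentiableOn ℂ (yy b) U := yy_diff h.db h.b0
lemma dyc (h : TD a b c) : DifferentiableOn ℂ (yy c) U := yy_diff h.dc h.c0

lemma jac (h : TD a b c) : ∀ τ ∈ U, b τ = a τ + c τ := by
  have key := cusp_zero (fun τ => (b τ - a τ - c τ) ^ 2) 4 (by norm_num)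
    (((h.db.sub h.da).sub h.dc).pow 2)
    (by
      intro τ hτ
      simp only [h.Ta τ hτ, h.Tb τ hτ, h.Tc τ hτ]
      ring)
    (by
      intro τ hτ
      simp only [h.Sa τ hτ, h.Sb τ hτ, h.Sc τ hτ]
      rw [show τ ^ (4 : ℤ) = τ ^ 4 from by norm_cast]
      ring)
    (by simpa using (((h.lb.sub h.la).sub h.lc).pow 2))
  intro τ hτ
  have := pow_eq_zero_iff (two_ne_zero) |>.mp (key τ hτ)
  linear_combination this

lemma logd (h : TD a b c) : ∀ τ ∈ U, yy a τ - yy b τ = c τ / 4 ∧ yy b τ - yy c τ = a τ / 4 := by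
  have k4 := cusp_zero (fun τ => (yy a τ - yy b τ - c τ / 4) * c τ
      + (yy a τ - yy c τ - b τ / 4) * b τ + (yy b τ - yy c τ - a τ / 4) * a τ) 4 (by norm_num)
    (((((h.dya.sub h.dyb).sub (h.dc.div_const 4)).mul h.dc).add
      (((h.dya.sub h.dyc).sub (h.db.div_const 4)).mul h.db)).add
      (((h.dyb.sub h.dyc).sub (h.da.div_const 4)).mul h.da))
    (by
      intro τ hτ
      simp only [yy_shift (by norm_num) h.da h.da h.Ta hτ, yy_shift (by norm_num) h.db h.dc h.Tb hτ,
        yy_shift (by norm_num) h.dc h.db h.Tc hτ, h.Ta τ hτ, h.Tb τ hτ, h.Tc τ hτ]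
      ring)
    (by
      intro τ hτ
      simp only [yy_inv h.da h.dc h.c0 h.Sa hτ, yy_inv h.db h.db h.b0 h.Sb hτ,
        yy_inv h.dc h.da h.a0 h.Sc hτ, h.Sa τ hτ, h.Sb τ hτ, h.Sc τ hτ]
      rw [show τ ^ (4 : ℤ) = τ ^ 4 from by norm_cast]
      ring)
    (by simpa using (((((h.lya.sub h.lyb).sub (h.lc.div_const 4)).mul h.lc).add
      (((h.lya.sub h.lyc).sub (h.lb.div_const 4)).mul h.lb)).add
      (((h.lyb.sub h.lyc).sub (h.la.div_const 4)).mul h.la)))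
  have k6 := cusp_zero (fun τ => (yy a τ - yy b τ - c τ / 4) * (a τ ^ 2 - b τ ^ 2)
      + (yy a τ - yy c τ - b τ / 4) * (a τ ^ 2 - c τ ^ 2)
      + (yy b τ - yy c τ - a τ / 4) * (b τ ^ 2 - c τ ^ 2)) 6 (by norm_num)
    (((((h.dya.sub h.dyb).sub (h.dc.div_const 4)).mul ((h.da.pow 2).sub (h.db.pow 2))).add
      (((h.dya.sub h.dyc).sub (h.db.div_const 4)).mul ((h.da.pow 2).sub (h.dc.pow 2)))).add
      (((h.dyb.sub h.dyc).sub (h.da.div_const 4)).mul ((h.db.pow 2).sub (h.dc.pow 2))))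
    (by
      intro τ hτ
      simp only [yy_shift (by norm_num) h.da h.da h.Ta hτ, yy_shift (by norm_num) h.db h.dc h.Tb hτ,
        yy_shift (by norm_num) h.dc h.db h.Tc hτ, h.Ta τ hτ, h.Tb τ hτ, h.Tc τ hτ]
      ring)
    (by
      intro τ hτ
      simp only [yy_inv h.da h.dc h.c0 h.Sa hτ, yy_inv h.db h.db h.b0 h.Sb hτ,
        yy_inv h.dc h.da h.a0 h.Sc hτ, h.Sa τ hτ, h.Sb τ hτ, h.Sc τ hτ]
      rw [show τ ^ (6 : ℤ) = τ ^ 6 from by norm_cast]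
      ring)
    (by simpa using
      (((((h.lya.sub h.lyb).sub (h.lc.div_const 4)).mul ((h.la.pow 2).sub (h.lb.pow 2))).add
      (((h.lya.sub h.lyc).sub (h.lb.div_const 4)).mul ((h.la.pow 2).sub (h.lc.pow 2)))).add
      (((h.lyb.sub h.lyc).sub (h.la.div_const 4)).mul ((h.lb.pow 2).sub (h.lc.pow 2)))))
  intro τ hτ
  have e4 := k4 τ hτ
  have e6 := k6 τ hτ
  have hb := h.jac τ hτ
  have hb0 := h.b0 τ hτ
  have ha0 := h.a0 τ hτ
  have hc0 := h.c0 τ hτ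
  rw [hb] at e4 e6 hb0
  set x := yy a τ - yy b τ - c τ / 4 with hx
  set z := yy b τ - yy c τ - a τ / 4 with hz
  have hg : yy a τ - yy c τ - (a τ + c τ) / 4 = x + z := by rw [hx, hz]; ring
  rw [hg] at e4 e6
  have hdet : 9 * (a τ * c τ * (a τ + c τ)) ≠ 0 :=
    mul_ne_zero (by norm_num) (mul_ne_zero (mul_ne_zero ha0 hc0) hb0)
  have x0 : x = 0 := by
    refine (mul_eq_zero.mp (?_ : 9 * (a τ * c τ * (a τ + c τ)) * x = 0)).resolve_left hdet
    linear_combination (2 * a τ ^ 2 + 2 * a τ * c τ - c τ ^ 2) * e4 - (c τ + 2 * a τ) * e6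
  have z0 : z = 0 := by
    refine (mul_eq_zero.mp (?_ : 9 * (a τ * c τ * (a τ + c τ)) * z = 0)).resolve_left hdet
    linear_combination (2 * c τ + a τ) * e6 - (a τ ^ 2 - 2 * a τ * c τ - 2 * c τ ^ 2) * e4
  constructor
  · exact sub_eq_zero.mp (hx.symm.trans x0)
  · exact sub_eq_zero.mp (hz.symm.trans z0)

lemma ric (h : TD a b c) : ∀ τ ∈ U, DD (yy a) τ = 2 * yy a τ ^ 2 - b τ * c τ / 8 ∧
    DD (yy b) τ = 2 * yy b τ ^ 2 + a τ * c τ / 8 ∧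
    DD (yy c) τ = 2 * yy c τ ^ 2 - a τ * b τ / 8 := by
  have k4 := cusp_zero (fun τ => rr a τ + rr b τ + rr c τ
      - (a τ * c τ - b τ * c τ - a τ * b τ) / 8) 4 (by norm_num)
    (by
      have da := h.da
      have db := h.db
      have dc := h.dc
      have dya := h.dya
      have dyb := h.dyb
      have dyc := h.dyc
      have ddya := DD_diff dya
      have ddyb := DD_diff dyb
      have ddyc := DD_diff dyc
      unfold rr
      fun_prop)
    (by
      intro τ hτ
      simp only [rr_shift (by norm_num) h.da h.da h.a0 h.a0 h.Ta hτ,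
        rr_shift (by norm_num) h.db h.dc h.b0 h.c0 h.Tb hτ,
        rr_shift (by norm_num) h.dc h.db h.c0 h.b0 h.Tc hτ, h.Ta τ hτ, h.Tb τ hτ, h.Tc τ hτ]
      ring)
    (by
      intro τ hτ
      simp only [rr_inv h.da h.dc h.a0 h.c0 h.Sa hτ, rr_inv h.db h.db h.b0 h.b0 h.Sb hτ,
        rr_inv h.dc h.da h.c0 h.a0 h.Sc hτ, h.Sa τ hτ, h.Sb τ hτ, h.Sc τ hτ]
      rw [show τ ^ (4 : ℤ) = τ ^ 4 from by norm_cast]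
      ring)
    (by
      have ra := (DD_tendsto h.dya h.lya).sub ((h.lya.pow 2).const_mul 2)
      have rb := (DD_tendsto h.dyb h.lyb).sub ((h.lyb.pow 2).const_mul 2)
      have rc := (DD_tendsto h.dyc h.lyc).sub ((h.lyc.pow 2).const_mul 2)
      have := ((ra.add rb).add rc).sub
        ((((h.la.mul h.lc).sub (h.lb.mul h.lc)).sub (h.la.mul h.lb)).div_const 8)
      convert! this using 2
      norm_num)
  intro τ hτ
  have e4 := k4 τ hτ
  simp only [rr] at e4
  have hb := h.jac τ hτ
  obtain ⟨l1, l2⟩ := h.logd τ hτ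
  have d1 : DD (yy a) τ - DD (yy b) τ = c τ * yy c τ := by
    have e := DD_congr (f := fun z => yy a z - yy b z) (g := fun z => c z / 4)
      (fun z hz => (h.logd z hz).1) hτ
    have e1 : DD (fun z => yy a z - yy b z) τ = DD (yy a) τ - DD (yy b) τ :=
      DD_eq (((DD_has h.dya hτ).sub (DD_has h.dyb hτ)).congr_deriv (by ring))
    have e2 : DD (fun z => c z / 4) τ = DD c τ / 4 :=
      DD_eq (((DD_has h.dc hτ).div_const 4).congr_deriv (by ring))
    rw [← e1, e, e2, DD_of_yy h.c0 hτ]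
    ring
  have d2 : DD (yy b) τ - DD (yy c) τ = a τ * yy a τ := by
    have e := DD_congr (f := fun z => yy b z - yy c z) (g := fun z => a z / 4)
      (fun z hz => (h.logd z hz).2) hτ
    have e1 : DD (fun z => yy b z - yy c z) τ = DD (yy b) τ - DD (yy c) τ :=
      DD_eq (((DD_has h.dyb hτ).sub (DD_has h.dyc hτ)).congr_deriv (by ring))
    have e2 : DD (fun z => a z / 4) τ = DD a τ / 4 :=
      DD_eq (((DD_has h.da hτ).div_const 4).congr_deriv (by ring))
    rw [← e1, e, e2, DD_of_yy h.a0 hτ]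
    ring
  have hyb : yy b τ = yy a τ - c τ / 4 := by linear_combination -l1
  have hyc : yy c τ = yy a τ - c τ / 4 - a τ / 4 := by linear_combination -l1 - l2
  generalize DD (yy a) τ = Da at *
  generalize DD (yy b) τ = Db at *
  generalize DD (yy c) τ = Dc at *
  generalize yy a τ = Ya at *
  generalize yy b τ = Yb at *
  generalize yy c τ = Yc at *
  generalize a τ = A at *
  generalize b τ = B at *
  generalize c τ = C at *
  have D1 : Db = Da - C * Yc := by linear_combination -d1
  have D2 : Dc = Db - A * Ya := by linear_combination -d2
  subst D2 D1 hyc hyb hb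
  refine ⟨?_, ?_, ?_⟩
  · linear_combination e4 / 3
  · linear_combination e4 / 3
  · linear_combination e4 / 3

end TD

/-- The differential equation, from a closed first order system. -/
lemma ode (t F G y w : ℂ → ℂ) (e : ℂ) (dt : DifferentiableOn ℂ t U)
    (dF : DifferentiableOn ℂ F U) (dG : DifferentiableOn ℂ G U) (dy : DifferentiableOn ℂ y U)
    (F0 : ∀ τ ∈ U, F τ ≠ 0) (G0 : ∀ τ ∈ U, G τ ≠ 0)
    (ht : ∀ τ ∈ U, DD t τ = y τ * t τ)
    (hy : ∀ τ ∈ U, DD y τ = 2 * y τ ^ 2 + e * (F τ * G τ) / 8)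
    (hw : ∀ τ ∈ U, 4 * yy F τ + 4 * yy G τ - 8 * y τ = w τ)
    (hw2 : ∀ τ ∈ U, w τ ^ 2 + 4 * e * (F τ * G τ) = t τ ^ 8) (τ : ℂ) (hτ : τ ∈ U) :
    (t τ ^ 2 * DD (DD (DD t)) τ - 15 * t τ * DD t τ * DD (DD t) τ + 30 * DD t τ ^ 3) ^ 2 +
        32 * (t τ * DD (DD t) τ - 3 * DD t τ ^ 2) ^ 3 =
      t τ ^ 10 * (t τ * DD (DD t) τ - 3 * DD t τ ^ 2) ^ 2 := by
  have h2 : ∀ τ ∈ U, DD (DD t) τ = (3 * y τ ^ 2 + e * (F τ * G τ) / 8) * t τ := by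
    intro τ hτ
    rw [DD_congr ht hτ]
    apply DD_eq
    refine ((DD_has dy hτ).mul (DD_has dt hτ)).congr_deriv ?_
    rw [hy τ hτ, ht τ hτ]
    ring
  have h3 : DD (DD (DD t)) τ = (6 * y τ * (2 * y τ ^ 2 + e * (F τ * G τ) / 8)
      + e * (4 * yy F τ + 4 * yy G τ) * (F τ * G τ) / 8
      + (3 * y τ ^ 2 + e * (F τ * G τ) / 8) * y τ) * t τ := by
    rw [DD_congr h2 hτ]
    apply DD_eq
    have H := (((((DD_has dy hτ).pow 2).const_mul 3).add
      ((((DD_has dF hτ).mul (DD_has dG hτ)).const_mul e).div_const 8)).mul (DD_has dt hτ))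
    refine H.congr_deriv ?_
    simp only [hy τ hτ, ht τ hτ, DD_of_yy F0 hτ, DD_of_yy G0 hτ, Pi.add_apply, Pi.mul_apply,
      Pi.pow_apply]
    push_cast
    ring
  have hFG : 4 * yy F τ + 4 * yy G τ = w τ + 8 * y τ := by linear_combination hw τ hτ
  rw [h3, h2 τ hτ, ht τ hτ, hFG]
  have := hw2 τ hτ
  generalize t τ = T at *
  generalize F τ = f at *
  generalize G τ = g at *
  linear_combination (e * (f * g) / 8) ^ 2 * T ^ 6 * this

/-- The theta-nulls in the variable of the nome. -/
def t3 : ℂ → ℂ := fun τ => jacobiTheta₂ 0 τ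
/-- Fourth theta-null. -/
def t4 : ℂ → ℂ := fun τ => jacobiTheta₂ (1 / 2) τ
/-- Holomorphic factor of the second theta-null. -/
def g2 : ℂ → ℂ := fun τ => jacobiTheta₂ (τ / 2) τ
/-- Second theta-null. -/
def t2 : ℂ → ℂ := fun τ => Complex.exp (Real.pi * Complex.I * τ / 4) * g2 τ

lemma dt3 : DifferentiableOn ℂ t3 U := fun _ hτ =>
  (differentiableAt_jacobiTheta₂_snd 0 hτ).differentiableWithinAt

lemma dt4 : DifferentiableOn ℂ t4 U := fun _ hτ =>
  (differentiableAt_jacobiTheta₂_snd (1 / 2) hτ).differentiableWithinAt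

lemma dg2 : DifferentiableOn ℂ g2 U := fun τ hτ => by
  have h1 := (hasFDerivAt_jacobiTheta₂ (τ / 2) hτ).differentiableAt
  have h2 : DifferentiableAt ℂ (fun z : ℂ => (z / 2, z)) τ := by fun_prop
  exact (DifferentiableAt.comp τ (f := fun z : ℂ => (z / 2, z))
    (g := fun p : ℂ × ℂ => jacobiTheta₂ p.1 p.2) h1
    h2).differentiableWithinAt

lemma dt2 : DifferentiableOn ℂ t2 U := by
  refine DifferentiableOn.mul ?_ dg2
  fun_prop

lemma exp_even {m : ℤ} (hm : Even m) : Complex.exp (Real.pi * Complex.I * m) = 1 := by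
  obtain ⟨k, rfl⟩ := hm
  rw [Complex.exp_eq_one_iff]
  exact ⟨k, by push_cast; ring⟩

lemma t3_add (τ : ℂ) : t3 (τ + 1) = t4 τ := by
  refine tsum_congr fun n => ?_
  unfold jacobiTheta₂_term
  have h := exp_even (m := n ^ 2 - n) (by
    rw [show n ^ 2 - n = (n - 1) * (n - 1 + 1) by ring]; exact Int.even_mul_succ_self _)
  have e : Complex.exp (2 * Real.pi * Complex.I * n * 0 + Real.pi * Complex.I * n ^ 2 * (τ + 1)) =
      Complex.exp (2 * Real.pi * Complex.I * n * (1 / 2) + Real.pi * Complex.I * n ^ 2 * τ) *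
        Complex.exp (Real.pi * Complex.I * ((n ^ 2 - n : ℤ) : ℂ)) := by
    rw [← Complex.exp_add]
    congr 1
    push_cast
    ring
  rw [e, h, mul_one]

lemma t4_add (τ : ℂ) : t4 (τ + 1) = t3 τ := by
  rw [← t3_add]
  unfold t3
  rw [← jacobiTheta₂_add_right 0 τ]
  congr 1
  ring

lemma g2_add (τ : ℂ) : g2 (τ + 1) = g2 τ := by
  refine tsum_congr fun n => ?_
  unfold jacobiTheta₂_term
  have h := exp_even (m := n * (n + 1)) (Int.even_mul_succ_self _)
  have e : Complex.exp (2 * Real.pi * Complex.I * n * ((τ + 1) / 2) +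
        Real.pi * Complex.I * n ^ 2 * (τ + 1)) =
      Complex.exp (2 * Real.pi * Complex.I * n * (τ / 2) + Real.pi * Complex.I * n ^ 2 * τ) *
        Complex.exp (Real.pi * Complex.I * ((n * (n + 1) : ℤ) : ℂ)) := by
    rw [← Complex.exp_add]
    congr 1
    push_cast
    ring
  rw [e, h, mul_one]

lemma t2_pow (τ : ℂ) : t2 τ ^ 4 = Complex.exp (Real.pi * Complex.I * τ) * g2 τ ^ 4 := by
  unfold t2
  rw [mul_pow, ← Complex.exp_nat_mul]
  congr 2
  push_cast
  ring

lemma t2_add (τ : ℂ) : t2 (τ + 1) ^ 4 = -1 * t2 τ ^ 4 := by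
  rw [t2_pow, t2_pow, g2_add, mul_add, Complex.exp_add, mul_one, Complex.exp_pi_mul_I]
  ring

lemma s_pow {τ : ℂ} : ((-Complex.I * τ) ^ (1 / 2 : ℂ)) ^ 4 = -τ ^ 2 := by
  rw [← Complex.cpow_nat_mul, show ((4 : ℕ) : ℂ) * (1 / 2) = ((2 : ℕ) : ℂ) by norm_num,
    Complex.cpow_natCast, mul_pow, neg_sq, Complex.I_sq]
  ring

lemma s_ne {τ : ℂ} (hτ : τ ∈ U) : (-Complex.I * τ) ^ (1 / 2 : ℂ) ≠ 0 := by
  intro h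
  have := s_pow (τ := τ)
  rw [h] at this
  have h0 := ne_zero_of_U hτ
  simp [h0] at this

lemma t3_inv {τ : ℂ} (hτ : τ ∈ U) : t3 (-1 / τ) = (-Complex.I * τ) ^ (1 / 2 : ℂ) * t3 τ := by
  have h := jacobiTheta₂_functional_equation 0 τ
  have hs := s_ne hτ
  unfold t3
  rw [h]
  simp only [zero_div, ne_eq, OfNat.ofNat_ne_zero, not_false_eq_true, zero_pow, mul_zero,
    Complex.exp_zero]
  rw [mul_one, ← mul_assoc, mul_one_div_cancel hs, one_mul]

lemma t2_inv {τ : ℂ} (hτ : τ ∈ U) : t2 (-1 / τ) = (-Complex.I * τ) ^ (1 / 2 : ℂ) * t4 τ := by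
  have h := jacobiTheta₂_functional_equation (1 / 2) τ
  have hs := s_ne hτ
  have h0 := ne_zero_of_U hτ
  unfold t2 t4 g2
  rw [h, ← jacobiTheta₂_neg_left, show -(-1 / τ / 2) = 1 / 2 / τ by field_simp,
    show Real.pi * Complex.I * (-1 / τ) / 4 = -Real.pi * Complex.I * (1 / 2) ^ 2 / τ by
      field_simp; norm_num]
  rw [← mul_assoc, ← mul_assoc, mul_one_div_cancel hs, one_mul]

lemma t4_inv {τ : ℂ} (hτ : τ ∈ U) : t4 (-1 / τ) = (-Complex.I * τ) ^ (1 / 2 : ℂ) * t2 τ := by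
  have h := jacobiTheta₂_functional_equation (τ / 2) τ
  have hs := s_ne hτ
  have h0 := ne_zero_of_U hτ
  unfold t2 t4 g2
  rw [h, show τ / 2 / τ = 1 / 2 by field_simp]
  have he : Complex.exp (Real.pi * Complex.I * τ / 4) *
      Complex.exp (-Real.pi * Complex.I * (τ / 2) ^ 2 / τ) = 1 := by
    rw [← Complex.exp_add, Complex.exp_eq_one_iff]
    refine ⟨0, ?_⟩
    field_simp
    push_cast
    ring
  generalize Complex.exp (Real.pi * Complex.I * τ / 4) = E1 at *
  generalize Complex.exp (-Real.pi * Complex.I * (τ / 2) ^ 2 / τ) = E2 at *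
  generalize jacobiTheta₂ (1 / 2) (-1 / τ) = J at *
  generalize (-Complex.I * τ) ^ (1 / 2 : ℂ) = s at *
  have : s * (1 / s) = 1 := mul_one_div_cancel hs
  linear_combination -J * this - s * (1 / s) * J * he

lemma lt3 : Tendsto t3 L (𝓝 1) := by
  have h := isBigO_at_im_infty_jacobiTheta_sub_one
  have h1 : Tendsto (fun τ : ℂ => Real.exp (-Real.pi * τ.im)) L (𝓝 0) := by
    have h2 : Tendsto (fun x : ℝ => Real.exp (-Real.pi * x)) atTop (𝓝 0) := by
      refine Real.tendsto_exp_atBot.comp ?_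
      exact tendsto_id.const_mul_atTop_of_neg (by simpa using Real.pi_pos)
    exact h2.comp tendsto_comap
  have h3 := h.trans_tendsto h1
  have h4 := h3.add_const 1
  simp only [sub_add_cancel, zero_add] at h4
  refine h4.congr fun τ => ?_
  exact jacobiTheta_eq_jacobiTheta₂ τ

lemma lt4 : Tendsto t4 L (𝓝 1) := by
  have h1 : Tendsto (fun τ : ℂ => τ + 1) L L := by
    refine tendsto_comap_iff.mpr ?_
    refine (tendsto_comap (f := Complex.im) (x := atTop)).congr fun τ => ?_
    simp
  exact (lt3.comp h1).congr fun τ => t3_add τ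

lemma norm_g2_term (n : ℤ) (τ : ℂ) :
    ‖jacobiTheta₂_term n (τ / 2) τ‖ = Real.exp (-Real.pi * ((n * (n + 1) : ℤ) : ℝ) * τ.im) := by
  rw [norm_jacobiTheta₂_term]
  congr 1
  have : (τ / 2).im = τ.im / 2 := by simp
  rw [this]
  push_cast
  ring

lemma int_nonneg (n : ℤ) : 0 ≤ n * (n + 1) := by
  rcases le_or_gt 0 n with h | h
  · positivity
  · nlinarith

lemma lg2 : Tendsto g2 L (𝓝 2) := by
  have hsum : Summable fun n : ℤ => ‖jacobiTheta₂_term n (Complex.I / 2) Complex.I‖ :=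
    ((summable_jacobiTheta₂_term_iff _ _).mpr (by simp)).norm
  have key := tendsto_tsum_of_dominated_convergence (𝓕 := L)
    (f := fun (τ : ℂ) (n : ℤ) => jacobiTheta₂_term n (τ / 2) τ)
    (g := fun n : ℤ => if n ∈ ({0, -1} : Finset ℤ) then (1 : ℂ) else 0)
    hsum (by
      intro n
      split_ifs with hn
      · simp only [Finset.mem_insert, Finset.mem_singleton] at hn
        refine tendsto_const_nhds.congr fun τ => ?_
        unfold jacobiTheta₂_term
        symm
        rw [Complex.exp_eq_one_iff]
        refine ⟨0, ?_⟩
        rcases hn with rfl | rfl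
        · simp
        · push_cast; ring
      · simp only [Finset.mem_insert, Finset.mem_singleton, not_or] at hn
        rw [tendsto_zero_iff_norm_tendsto_zero]
        have hpos : 0 < n * (n + 1) := by
          refine lt_of_le_of_ne (int_nonneg n) fun h => ?_
          rcases mul_eq_zero.mp h.symm with h | h
          · exact hn.1 h
          · exact hn.2 (by omega)
        have hpos' : (0 : ℝ) < ((n * (n + 1) : ℤ) : ℝ) := by exact_mod_cast hpos
        have h2 : Tendsto (fun x : ℝ => Real.exp (-Real.pi * ((n * (n + 1) : ℤ) : ℝ) * x))
            atTop (𝓝 0) := by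
          refine Real.tendsto_exp_atBot.comp ?_
          refine tendsto_id.const_mul_atTop_of_neg ?_
          have := mul_pos Real.pi_pos hpos'
          linarith
        have h3 := h2.comp (tendsto_comap (f := Complex.im) (x := atTop))
        exact h3.congr fun τ => (norm_g2_term n τ).symm)
    (by
      have : ∀ᶠ τ : ℂ in L, 1 ≤ τ.im :=
        (tendsto_comap (f := Complex.im) (x := atTop)).eventually (eventually_ge_atTop 1)
      filter_upwards [this] with τ hτ n
      rw [norm_g2_term, norm_g2_term, Real.exp_le_exp]
      have h1 : (0 : ℝ) ≤ ((n * (n + 1) : ℤ) : ℝ) := by exact_mod_cast int_nonneg n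
      have h2 := mul_nonneg Real.pi_pos.le h1
      rw [Complex.I_im]
      nlinarith)
  have hs : ∑' n : ℤ, (if n ∈ ({0, -1} : Finset ℤ) then (1 : ℂ) else 0) = 2 := by
    rw [tsum_eq_sum (s := ({0, -1} : Finset ℤ)) (fun n hn => if_neg hn)]
    rw [Finset.sum_pair (by decide)]
    norm_num
  rw [hs] at key
  exact key

lemma lexp : Tendsto (fun τ : ℂ => Complex.exp (Real.pi * Complex.I * τ)) L (𝓝 0) := by
  rw [tendsto_zero_iff_norm_tendsto_zero]
  have h2 : Tendsto (fun x : ℝ => Real.exp (-Real.pi * x)) atTop (𝓝 0) := by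
    refine Real.tendsto_exp_atBot.comp ?_
    exact tendsto_id.const_mul_atTop_of_neg (by simpa using Real.pi_pos)
  refine (h2.comp (tendsto_comap (f := Complex.im) (x := atTop))).congr fun τ => ?_
  rw [Complex.norm_exp]
  simp

lemma la : Tendsto (fun τ => t2 τ ^ 4) L (𝓝 0) := by
  have := lexp.mul (lg2.pow 4)
  rw [zero_mul] at this
  exact this.congr fun τ => (t2_pow τ).symm

lemma Sgen {t u : ℂ → ℂ} (h : ∀ τ ∈ U, t (-1 / τ) = (-Complex.I * τ) ^ (1 / 2 : ℂ) * u τ) :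
    ∀ τ ∈ U, (fun τ => t τ ^ 4) (-1 / τ) = -τ ^ 2 * (fun τ => u τ ^ 4) τ := by
  intro τ hτ
  simp only
  rw [h τ hτ, mul_pow, s_pow]

lemma prod_ne : ∀ τ ∈ U, t2 τ ^ 8 * t3 τ ^ 8 * t4 τ ^ 8 ≠ 0 := by
  apply cusp_twelve (fun τ => t2 τ ^ 8 * t3 τ ^ 8 * t4 τ ^ 8)
  · exact ((dt2.pow 8).mul (dt3.pow 8)).mul (dt4.pow 8)
  · intro τ hτ
    have h := t2_add τ
    simp only [t3_add, t4_add]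
    linear_combination (t2 (τ + 1) ^ 4 - t2 τ ^ 4) * t4 τ ^ 8 * t3 τ ^ 8 * h
  · intro τ hτ
    simp only [t2_inv hτ, t3_inv hτ, t4_inv hτ, mul_pow]
    have h := s_pow (τ := τ)
    rw [show τ ^ (12 : ℤ) = τ ^ 12 from by norm_cast]
    generalize (-Complex.I * τ) ^ (1 / 2 : ℂ) = s at *
    rw [show s ^ 8 = (s ^ 4) ^ 2 by ring, h]
    ring
  · have := ((la.pow 2).mul (lt3.pow 8)).mul (lt4.pow 8)
    simp only [ne_eq, OfNat.ofNat_ne_zero, not_false_eq_true, zero_pow, zero_mul] at this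
    refine this.congr fun τ => ?_
    ring
  · have h2 := lg2.eventually_ne (two_ne_zero)
    have h3 := lt3.eventually_ne (one_ne_zero)
    have h4 := lt4.eventually_ne (one_ne_zero)
    obtain ⟨τ, ⟨⟨h2, h3⟩, h4⟩, h5⟩ := (((h2.and h3).and h4).and U_mem_L).exists
    refine ⟨τ, h5, ?_⟩
    refine mul_ne_zero (mul_ne_zero (pow_ne_zero _ ?_) (pow_ne_zero _ h3)) (pow_ne_zero _ h4)
    exact mul_ne_zero (Complex.exp_ne_zero _) h2

lemma t2_ne {τ : ℂ} (hτ : τ ∈ U) : t2 τ ≠ 0 := fun h => prod_ne τ hτ (by rw [h]; simp)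
lemma t3_ne {τ : ℂ} (hτ : τ ∈ U) : t3 τ ≠ 0 := fun h => prod_ne τ hτ (by rw [h]; simp)
lemma t4_ne {τ : ℂ} (hτ : τ ∈ U) : t4 τ ≠ 0 := fun h => prod_ne τ hτ (by rw [h]; simp)

lemma lya : Tendsto (yy (fun τ => t2 τ ^ 4)) L (𝓝 (1 / 4)) := by
  have hg : DifferentiableOn ℂ (fun τ => g2 τ ^ 4) U := dg2.pow 4
  have h1 := (DD_tendsto hg (lg2.pow 4)).div ((lg2.pow 4).const_mul 4) (by norm_num)
  have h2 := h1.const_add (1 / 4)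
  rw [zero_div, add_zero] at h2
  refine h2.congr' ?_
  filter_upwards [U_mem_L] with τ hτ
  have e : DD (fun τ => t2 τ ^ 4) τ =
      Complex.exp (Real.pi * Complex.I * τ) * (g2 τ ^ 4 + DD (fun τ => g2 τ ^ 4) τ) := by
    rw [DD_congr (fun τ _ => t2_pow τ) hτ]
    apply DD_eq
    have he : HasDerivAt (fun z : ℂ => Complex.exp (Real.pi * Complex.I * z))
        (Complex.exp (Real.pi * Complex.I * τ) * (Real.pi * Complex.I)) τ := by
      simpa using ((hasDerivAt_id τ).const_mul (Real.pi * Complex.I : ℂ)).cexp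
    refine (he.mul (DD_has hg hτ)).congr_deriv ?_
    ring
  have hne : g2 τ ≠ 0 := fun h => t2_ne hτ (by simp [t2, h])
  have hE := Complex.exp_ne_zero (Real.pi * Complex.I * τ)
  simp only [yy]
  rw [e, t2_pow]
  simp only [Pi.div_apply]
  field_simp

lemma td : TD (fun τ => t2 τ ^ 4) (fun τ => t3 τ ^ 4) (fun τ => t4 τ ^ 4) where
  da := dt2.pow 4
  db := dt3.pow 4
  dc := dt4.pow 4
  a0 := fun _ hτ => pow_ne_zero _ (t2_ne hτ)
  b0 := fun _ hτ => pow_ne_zero _ (t3_ne hτ)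
  c0 := fun _ hτ => pow_ne_zero _ (t4_ne hτ)
  Ta := fun τ _ => t2_add τ
  Tb := fun τ _ => by simp only [t3_add, one_mul]
  Tc := fun τ _ => by simp only [t4_add, one_mul]
  Sa := Sgen fun _ hτ => t2_inv hτ
  Sb := Sgen fun _ hτ => t3_inv hτ
  Sc := Sgen fun _ hτ => t4_inv hτ
  la := la
  lb := by simpa using lt3.pow 4
  lc := by simpa using lt4.pow 4
  lya := lya

lemma DD_t {t : ℂ → ℂ} (dt : DifferentiableOn ℂ t U) (h0 : ∀ τ ∈ U, t τ ≠ 0) :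
    ∀ τ ∈ U, DD t τ = yy (fun τ => t τ ^ 4) τ * t τ := by
  intro τ hτ
  have e : DD (fun τ => t τ ^ 4) τ = 4 * t τ ^ 3 * DD t τ :=
    DD_eq (((DD_has dt hτ).pow 4).congr_deriv (by push_cast; ring))
  have := h0 τ hτ
  simp only [yy]
  rw [e]
  field_simp

/-- The conclusion for a function in the nome variable. -/
def Concl (D : (ℂ → ℂ) → ℂ → ℂ) (t : ℂ → ℂ) (τ : ℂ) : Prop :=
    (t τ ^ 2 * D (D (D t)) τ - 15 * t τ * D t τ * D (D t) τ + 30 * D t τ ^ 3) ^ 2 +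
        32 * (t τ * D (D t) τ - 3 * D t τ ^ 2) ^ 3 =
      t τ ^ 10 * (t τ * D (D t) τ - 3 * D t τ ^ 2) ^ 2

lemma concl3 : ∀ τ ∈ U, Concl DD t3 τ := by
  refine ode t3 (fun τ => t2 τ ^ 4) (fun τ => t4 τ ^ 4) (yy fun τ => t3 τ ^ 4)
    (fun τ => t4 τ ^ 4 - t2 τ ^ 4) 1 dt3 td.da td.dc td.dyb td.a0 td.c0
    (DD_t dt3 fun _ h => t3_ne h) ?_ ?_ ?_
  · intro τ hτ
    linear_combination (td.ric τ hτ).2.1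
  · intro τ hτ
    have := td.logd τ hτ
    linear_combination 4 * this.1 - 4 * this.2
  · intro τ hτ
    have := td.jac τ hτ
    linear_combination -(t3 τ ^ 4 + (t2 τ ^ 4 + t4 τ ^ 4)) * this

lemma concl2 : ∀ τ ∈ U, Concl DD t2 τ := by
  refine ode t2 (fun τ => t3 τ ^ 4) (fun τ => t4 τ ^ 4) (yy fun τ => t2 τ ^ 4)
    (fun τ => -t3 τ ^ 4 - t4 τ ^ 4) (-1) dt2 td.db td.dc td.dya td.b0 td.c0
    (DD_t dt2 fun _ h => t2_ne h) ?_ ?_ ?_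
  · intro τ hτ
    linear_combination (td.ric τ hτ).1
  · intro τ hτ
    have := td.logd τ hτ
    have hj := td.jac τ hτ
    linear_combination -8 * this.1 - 4 * this.2 + hj
  · intro τ hτ
    have := td.jac τ hτ
    linear_combination (t3 τ ^ 4 - t4 τ ^ 4 + t2 τ ^ 4) * this

lemma concl4 : ∀ τ ∈ U, Concl DD t4 τ := by
  refine ode t4 (fun τ => t2 τ ^ 4) (fun τ => t3 τ ^ 4) (yy fun τ => t4 τ ^ 4)
    (fun τ => t2 τ ^ 4 + t3 τ ^ 4) (-1) dt4 td.da td.db td.dyc td.a0 td.b0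
    (DD_t dt4 fun _ h => t4_ne h) ?_ ?_ ?_
  · intro τ hτ
    linear_combination (td.ric τ hτ).2.2
  · intro τ hτ
    have := td.logd τ hτ
    have hj := td.jac τ hτ
    linear_combination 4 * this.1 + 8 * this.2 - hj
  · intro τ hτ
    have := td.jac τ hτ
    linear_combination (t3 τ ^ 4 - t2 τ ^ 4 + t4 τ ^ 4) * this

lemma dq_scale (t : ℂ → ℂ) : dq (fun τ => t (2 * τ)) = fun τ => DD t (2 * τ) := by
  funext τ
  unfold dq DD
  rw [deriv_comp_mul_left]
  have := piI_ne
  rw [smul_eq_mul, mul_assoc 2, mul_inv]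
  ring

lemma concl_scale {t : ℂ → ℂ} (h : ∀ τ ∈ U, Concl DD t τ) {τ : ℂ} (hτ : 0 < τ.im) :
    Concl dq (fun τ => t (2 * τ)) τ := by
  have h2 : 2 * τ ∈ U := by simpa [U] using hτ
  have := h _ h2
  unfold Concl at this ⊢
  simp only [dq_scale]
  exact this

lemma theta3_eq : theta3 = fun τ => t3 (2 * τ) := by
  funext τ
  refine tsum_congr fun n => ?_
  unfold jacobiTheta₂_term
  congr 1
  ring

lemma theta2_eq : theta2 = fun τ => t2 (2 * τ) := by
  funext τ
  unfold theta2 t2 g2 jacobiTheta₂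
  rw [← tsum_mul_left]
  refine tsum_congr fun n => ?_
  unfold jacobiTheta₂_term
  rw [← Complex.exp_add]
  congr 1
  ring

lemma theta4_eq : theta4 = fun τ => t4 (2 * τ) := by
  funext τ
  refine tsum_congr fun n => ?_
  unfold jacobiTheta₂_term
  rw [← Complex.exp_pi_mul_I, ← Complex.exp_int_mul, ← Complex.exp_add]
  congr 1
  ring

end JTO

theorem jacobi_third_order_ode
    (ϑ : ℂ → ℂ) (hϑ : ϑ = theta2 ∨ ϑ = theta3 ∨ ϑ = theta4)
    (τ : ℂ) (hτ : 0 < τ.im) :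
    (ϑ τ ^ 2 * dq (dq (dq ϑ)) τ - 15 * ϑ τ * dq ϑ τ * dq (dq ϑ) τ + 30 * dq ϑ τ ^ 3) ^ 2 +
        32 * (ϑ τ * dq (dq ϑ) τ - 3 * dq ϑ τ ^ 2) ^ 3 =
      ϑ τ ^ 10 * (ϑ τ * dq (dq ϑ) τ - 3 * dq ϑ τ ^ 2) ^ 2 := by
  rcases hϑ with rfl | rfl | rfl
  · have := JTO.concl_scale JTO.concl2 hτ
    rw [← JTO.theta2_eq] at this
    exact this
  · have := JTO.concl_scale JTO.concl3 hτ
    rw [← JTO.theta3_eq] at this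
    exact this
  · have := JTO.concl_scale JTO.concl4 hτ
    rw [← JTO.theta4_eq] at this
    exact this
end
end

section
/- The Type-II differential system attached to the Fricke group Γ₀⁺(2): set X = θ₂⁴ + θ₃⁴, Y = η(τ)^{16}/η(2τ)⁸ − 64·η(2τ)^{16}/η(τ)⁸, Z = 256·η(τ)⁸·η(2τ)⁸, and ℰ₈ := Z′/Z. Then for all τ in the upper half-plane: X⁴ = Y² + Z; ℰ₈(τ) = (1/3)[2E₂(q²) + E₂(q)] = 1 − 8∑_{n≥1} σ₁(n; 2,1) qⁿ; (X⁴)′ = ℰ₈·X⁴ − X³·Y; (Y²)′ = ℰ₈·Y² − X³·Y; and 8·ℰ₈′ = ℰ₈² − X². -/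
open Complex

noncomputable section

/-- q = exp(2πiτ). -/
def qq (τ : ℂ) : ℂ := Complex.exp (2 * Real.pi * Complex.I * τ)

/-- The Dedekind eta function η(τ) = exp(πiτ/12)·∏_{n≥1} (1 − qⁿ). -/
def dedekindEta (τ : ℂ) : ℂ :=
  Complex.exp (Real.pi * Complex.I * τ / 12) * ∏' n : ℕ, (1 - qq τ ^ (n + 1))

/-- X = θ₂⁴ + θ₃⁴. -/
def Xf (τ : ℂ) : ℂ := theta2 τ ^ 4 + theta3 τ ^ 4

/-- Y = η(τ)¹⁶/η(2τ)⁸ − 64·η(2τ)¹⁶/η(τ)⁸. -/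
def Yf (τ : ℂ) : ℂ :=
  dedekindEta τ ^ 16 / dedekindEta (2 * τ) ^ 8 -
    64 * dedekindEta (2 * τ) ^ 16 / dedekindEta τ ^ 8

/-- Z = 256·η(τ)⁸·η(2τ)⁸. -/
def Zf (τ : ℂ) : ℂ := 256 * dedekindEta τ ^ 8 * dedekindEta (2 * τ) ^ 8

/-- ℰ₈ := Z′/Z. -/
def E8sig : ℂ → ℂ := fun τ => dq Zf τ / Zf τ

/-- The quasi-modular Eisenstein series E₂ as a function of its argument q:
E₂(x) = 1 − 24 ∑_{n≥1} σ₁(n) xⁿ. -/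
def EisE2 (x : ℂ) : ℂ := 1 - 24 * ∑' n : ℕ, (∑ d ∈ (n + 1).divisors, (d : ℂ)) * x ^ (n + 1)

/-- The χ-weighted divisor function σ_k(n; χ) = ∑_{d∣n} χ(d mod N) d^k. -/
def wdiv (k N : ℕ) (χ : ℕ → ℂ) (n : ℕ) : ℂ := ∑ d ∈ n.divisors, χ (d % N) * (d : ℂ) ^ k



section ModForm
open UpperHalfPlane ModularForm ModularGroup MatrixGroups CongruenceSubgroup Filter Topology
open scoped Manifold

/-- The filter of points of `ℂ` with imaginary part tending to infinity. -/
abbrev imInf : Filter ℂ := Filter.comap Complex.im Filter.atTop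

lemma tendsto_coe_imInf : Tendsto (fun z : ℍ => (z : ℂ)) atImInfty imInf := by
  rw [tendsto_comap_iff]
  exact tendsto_comap

lemma slashS_of (f : ℂ → ℂ) (k : ℤ)
    (hS : ∀ z : ℂ, 0 < z.im → f (-1 / z) = z ^ k * f z) :
    (fun z : ℍ => f z) ∣[k] S = fun z : ℍ => f z := by
  ext z
  rw [SL_slash_apply, UpperHalfPlane.modular_S_smul]
  have h := hS z z.2
  have hz : (z : ℂ) ≠ 0 := ne_zero z
  have e : (-1 / (z : ℂ)) = (-(z : ℂ))⁻¹ := by rw [inv_neg, neg_div, one_div]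
  rw [e] at h
  change f ((-(z : ℂ))⁻¹) * _ = f z
  rw [h, denom_S, zpow_neg]
  have h2 : (z : ℂ) ^ k ≠ 0 := zpow_ne_zero _ hz
  field_simp

lemma slashT_of (f : ℂ → ℂ) (k : ℤ)
    (hT : ∀ z : ℂ, 0 < z.im → f (z + 1) = f z) :
    (fun z : ℍ => f z) ∣[k] T = fun z : ℍ => f z := by
  ext z
  rw [SL_slash_apply, modular_T_smul]
  have h := hT z z.2
  have hd : denom (T : GL (Fin 2) ℝ) z = 1 := by
    rw [ModularGroup.denom_apply, ModularGroup.coe_T]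
    simp
  have hc : (((1 : ℝ) +ᵥ z : ℍ) : ℂ) = z + 1 := by
    rw [UpperHalfPlane.coe_vadd]; push_cast; ring
  simp only [hc, h, hd, one_zpow, mul_one]

/-- Cusp form of level one from a function on `ℂ`. -/
def mkCusp (f : ℂ → ℂ) (k : ℤ) (hd : DifferentiableOn ℂ f {z | 0 < z.im})
    (hT : ∀ z : ℂ, 0 < z.im → f (z + 1) = f z)
    (hS : ∀ z : ℂ, 0 < z.im → f (-1 / z) = z ^ k * f z)
    (h0 : Tendsto f imInf (𝓝 0)) : CuspForm 𝒮ℒ k where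
  toFun := fun z : ℍ => f z
  slash_action_eq' A hA := by
    obtain ⟨A, rfl⟩ := hA
    exact SlashInvariantForm.slash_action_generators_SL2Z (slashS_of f k hS) (slashT_of f k hT) A
  holo' := by
    rw [UpperHalfPlane.mdifferentiable_iff]
    refine hd.congr fun z hz ↦ ?_
    simp [ofComplex_apply_of_im_pos hz]
  zero_at_cusps' hc := by
    rw [Subgroup.IsArithmetic.isCusp_iff_isCusp_SL2Z] at hc
    rw [OnePoint.isZeroAt_iff_forall_SL2Z hc]
    intro γ _
    rw [SlashInvariantForm.slash_action_generators_SL2Z (slashS_of f k hS) (slashT_of f k hT)]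
    exact h0.comp tendsto_coe_imInf

lemma levelOne_eq_zero (f : ℂ → ℂ) (k : ℤ) (hk : k < 12)
    (hd : DifferentiableOn ℂ f {z | 0 < z.im})
    (hT : ∀ z : ℂ, 0 < z.im → f (z + 1) = f z)
    (hS : ∀ z : ℂ, 0 < z.im → f (-1 / z) = z ^ k * f z)
    (h0 : Tendsto f imInf (𝓝 0)) (z : ℂ) (hz : 0 < z.im) : f z = 0 := by
  have h := rank_zero_iff_forall_zero.mp (CuspForm.rank_eq_zero_of_weight_lt_twelve hk)
    (mkCusp f k hd hT hS h0)
  exact DFunLike.congr_fun h (⟨z, hz⟩ : ℍ)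

lemma levelOne_twelve (f : ℂ → ℂ)
    (hd : DifferentiableOn ℂ f {z | 0 < z.im})
    (hT : ∀ z : ℂ, 0 < z.im → f (z + 1) = f z)
    (hS : ∀ z : ℂ, 0 < z.im → f (-1 / z) = z ^ (12 : ℤ) * f z)
    (h0 : Tendsto f imInf (𝓝 0)) :
    ∃ c : ℂ, ∀ z : ℂ, 0 < z.im → f z = c * ModularForm.eta z ^ 24 := by
  obtain ⟨c, hc⟩ := CuspForm.exists_smul_discriminant_of_weight_eq_twelve
    (mkCusp f 12 hd hT hS h0)
  exact ⟨c, fun z hz => (DFunLike.congr_fun hc (⟨z, hz⟩ : ℍ)).symm⟩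

lemma eta_S_pow8 (z : ℂ) (hz : 0 < z.im) :
    ModularForm.eta (-1 / z) ^ 8 = z ^ 4 * ModularForm.eta z ^ 8 := by
  have he : ModularForm.eta (-1 / z) = (sqrt Complex.I)⁻¹ * (sqrt z * ModularForm.eta z) := by
    simpa using eta_comp_eq_csqrt_I_inv hz
  have hp (w : ℂ) (hw : w ≠ 0) : sqrt w ^ 8 = w ^ 4 := by
    rw [sqrt_eq_exp hw, ← exp_nat_mul]
    ring_nf
    rw [show (log w * 4) = (4 : ℕ) * log w by ring, exp_nat_mul, exp_log hw]
  have hz0 : z ≠ 0 := by rintro rfl; simp at hz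
  rw [he, mul_pow, mul_pow, inv_pow, hp _ I_ne_zero, hp _ hz0, I_pow_four]
  simp

end ModForm


section Theta
open Filter Topology

/-- Standard thetas, in the variable `T = 2τ`. -/
def th3 (T : ℂ) : ℂ := theta3 (T / 2)
def th2 (T : ℂ) : ℂ := theta2 (T / 2)
def th4 (T : ℂ) : ℂ := th3 (T + 1)

lemma theta3_eq (τ : ℂ) : theta3 τ = jacobiTheta₂ 0 (2 * τ) := by
  refine tsum_congr fun m => ?_
  rw [jacobiTheta₂_term]; congr 1; ring

lemma theta2_eq (τ : ℂ) :
    theta2 τ = cexp (Real.pi * I * τ / 2) * jacobiTheta₂ τ (2 * τ) := by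
  rw [theta2, jacobiTheta₂, ← tsum_mul_left]
  refine tsum_congr fun m => ?_
  rw [jacobiTheta₂_term, ← Complex.exp_add]; congr 1; ring

lemma th3_eq (T : ℂ) : th3 T = jacobiTheta₂ 0 T := by
  rw [th3, theta3_eq]; congr 1; ring

lemma th2_eq (T : ℂ) : th2 T = cexp (Real.pi * I * T / 4) * jacobiTheta₂ (T / 2) T := by
  rw [th2, theta2_eq]; congr 2 <;> ring

lemma th4_eq (T : ℂ) : th4 T = jacobiTheta₂ (1 / 2) T := by
  rw [th4, th3_eq]
  refine tsum_congr fun m => ?_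
  rw [jacobiTheta₂_term, jacobiTheta₂_term, Complex.exp_eq_exp_iff_exists_int]
  obtain ⟨k, hk⟩ := Int.even_mul_succ_self (m - 1)
  refine ⟨k, ?_⟩
  have hk' : ((m : ℂ) - 1) * m = k + k := by
    have : (m - 1) * m = k + k := by rw [← hk]; ring
    exact_mod_cast this
  linear_combination (Real.pi * I : ℂ) * hk'

lemma th3_S (T : ℂ) (hT : 0 < T.im) : th3 (-1 / T) ^ 8 = T ^ 4 * th3 T ^ 8 := by
  have hT0 : T ≠ 0 := by rintro rfl; simp at hT
  have h := jacobiTheta₂_functional_equation 0 T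
  rw [th3_eq, th3_eq, h]
  have h1 : ((-I * T) ^ (1 / 2 : ℂ)) ^ 8 = T ^ 4 := by
    rw [← Complex.cpow_nat_mul]
    rw [show ((8 : ℕ) : ℂ) * (1 / 2) = (4 : ℕ) by norm_num, Complex.cpow_natCast, mul_pow]
    have h4 : (-I) ^ 4 = 1 := by rw [neg_pow, I_pow_four]; norm_num
    rw [h4, one_mul]
  simp only [mul_pow, div_pow, h1, one_pow]
  simp
  field_simp

lemma th4_S' (T : ℂ) (hT : 0 < T.im) : th2 (-1 / T) ^ 8 = T ^ 4 * th4 T ^ 8 := by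
  have hT0 : T ≠ 0 := by rintro rfl; simp at hT
  have h := jacobiTheta₂_functional_equation (1 / 2) T
  rw [th4_eq, th2_eq, h]
  have h1 : ((-I * T) ^ (1 / 2 : ℂ)) ^ 8 = T ^ 4 := by
    rw [← Complex.cpow_nat_mul]
    rw [show ((8 : ℕ) : ℂ) * (1 / 2) = (4 : ℕ) by norm_num, Complex.cpow_natCast, mul_pow]
    have h4 : (-I) ^ 4 = 1 := by rw [neg_pow, I_pow_four]; norm_num
    rw [h4, one_mul]
  have h2 : jacobiTheta₂ (1 / 2 / T) (-1 / T) = jacobiTheta₂ (-1 / T / 2) (-1 / T) := by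
    rw [← jacobiTheta₂_neg_left]; congr 1; ring
  rw [h2]
  have h3 : cexp (Real.pi * I * (-1 / T) / 4) = cexp (-Real.pi * I * (1 / 2) ^ 2 / T) := by
    congr 1; ring
  rw [h3]
  simp only [mul_pow, div_pow, h1, one_pow]
  field_simp

lemma im_neg_inv_pos (T : ℂ) (hT : 0 < T.im) : 0 < (-1 / T).im := by
  have h := UpperHalfPlane.im_inv_neg_coe_pos ⟨T, hT⟩
  rw [neg_div, one_div, ← inv_neg]; exact h

lemma th2_S' (T : ℂ) (hT : 0 < T.im) : th4 (-1 / T) ^ 8 = T ^ 4 * th2 T ^ 8 := by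
  have hT0 : T ≠ 0 := by rintro rfl; simp at hT
  have h := th4_S' (-1 / T) (im_neg_inv_pos T hT)
  rw [show -1 / (-1 / T) = T by field_simp] at h
  rw [h]
  field_simp

lemma th4_add_one (T : ℂ) : th4 (T + 1) = th3 T := by
  rw [th4, th3_eq, th3_eq, add_assoc, one_add_one_eq_two, jacobiTheta₂_add_right]

lemma theta2_add_one (τ : ℂ) : theta2 (τ + 1) = I * theta2 τ := by
  rw [theta2, theta2, ← tsum_mul_left]
  refine tsum_congr fun m => ?_
  have (x : ℂ) : I * x = cexp (Real.pi / 2 * I) * x := by rw [Complex.exp_pi_div_two_mul_I]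
  rw [this]
  rw [← Complex.exp_add, Complex.exp_eq_exp_iff_exists_int]
  refine ⟨m ^ 2 + m, ?_⟩
  push_cast; ring

lemma theta3_add_one (τ : ℂ) : theta3 (τ + 1) = theta3 τ := by
  rw [theta3_eq, theta3_eq, mul_add, mul_one, jacobiTheta₂_add_right]

lemma th2_add_one (T : ℂ) : th2 (T + 1) ^ 8 = th2 T ^ 8 := by
  rw [th2, th2, theta2, theta2]
  have : ∑' m : ℤ, cexp (2 * Real.pi * I * ((T + 1) / 2) * ((m : ℂ) + 1 / 2) ^ 2) =
      cexp (Real.pi * I / 4) * ∑' m : ℤ, cexp (2 * Real.pi * I * (T / 2) * ((m : ℂ) + 1 / 2) ^ 2) := by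
    rw [← tsum_mul_left]
    refine tsum_congr fun m => ?_
    rw [← Complex.exp_add, Complex.exp_eq_exp_iff_exists_int]
    obtain ⟨k, hk⟩ := Int.even_mul_succ_self m
    refine ⟨k, ?_⟩
    have hk' : (m : ℂ) * (m + 1) = k + k := by exact_mod_cast hk
    linear_combination (Real.pi * I : ℂ) * hk'
  rw [this, mul_pow, ← Complex.exp_nat_mul,
    show ((8 : ℕ) : ℂ) * (Real.pi * I / 4) = 2 * Real.pi * I by push_cast; ring,
    Complex.exp_two_pi_mul_I, one_mul]

/-- The two sublattices of `ℤ²` by parity. -/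
def parEquiv : (ℤ × ℤ) ⊕ (ℤ × ℤ) ≃ ℤ × ℤ where
  toFun := Sum.elim (fun p => (p.1 + p.2, p.1 - p.2)) (fun p => (p.1 + p.2 + 1, p.1 - p.2))
  invFun := fun p => if (p.1 + p.2) % 2 = 0 then Sum.inl ((p.1 + p.2) / 2, (p.1 - p.2) / 2)
    else Sum.inr ((p.1 + p.2) / 2, (p.1 - p.2) / 2)
  left_inv := by
    rintro (⟨a, b⟩ | ⟨a, b⟩)
    · have : (a + b + (a - b)) % 2 = 0 := by omega
      simp only [Sum.elim_inl, this, if_true]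
      congr 2 <;> omega
    · have : ¬ (a + b + 1 + (a - b)) % 2 = 0 := by omega
      simp only [Sum.elim_inr, this, if_false]
      congr 2 <;> omega
  right_inv := by
    rintro ⟨a, b⟩
    by_cases h : (a + b) % 2 = 0
    · simp only [h, if_true, Sum.elim_inl]
      congr 1 <;> omega
    · simp only [h, if_false, Sum.elim_inr]
      congr 1 <;> omega

lemma sq_split {f g a b c d : ℤ → ℂ} (hf : Summable f) (hg : Summable g)
    (ha : Summable a) (hb : Summable b) (hc : Summable c) (hd : Summable d)
    (h1 : ∀ m n, f (m + n) * g (m - n) = a m * b n)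
    (h2 : ∀ m n, f (m + n + 1) * g (m - n) = c m * d n) :
    (∑' n, f n) * (∑' n, g n) = (∑' n, a n) * (∑' n, b n) + (∑' n, c n) * (∑' n, d n) := by
  have hs {u v : ℤ → ℂ} (hu : Summable u) (hv : Summable v) :
      HasSum (fun p : ℤ × ℤ => u p.1 * v p.2) ((∑' n, u n) * (∑' n, v n)) := by
    have := summable_mul_of_summable_norm hu.norm hv.norm
    rw [tsum_mul_tsum_of_summable_norm hu.norm hv.norm]
    exact this.hasSum
  have hL := hs hf hg
  rw [← parEquiv.hasSum_iff] at hL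
  have hR : HasSum ((fun p : ℤ × ℤ => f p.1 * g p.2) ∘ parEquiv)
      ((∑' n, a n) * (∑' n, b n) + (∑' n, c n) * (∑' n, d n)) := by
    apply HasSum.sum
    · convert hs ha hb using 1
      ext ⟨m, n⟩
      exact h1 m n
    · convert hs hc hd using 1
      ext ⟨m, n⟩
      exact h2 m n
  exact hL.unique hR

lemma summable_theta3 (τ : ℂ) (hτ : 0 < τ.im) :
    Summable fun m : ℤ => cexp (2 * Real.pi * I * τ * (m : ℂ) ^ 2) := by
  have h := (summable_jacobiTheta₂_term_iff 0 (2 * τ)).mpr (by simpa using hτ)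
  refine h.congr fun m => ?_
  rw [jacobiTheta₂_term]; congr 1; ring

lemma summable_theta2 (τ : ℂ) (hτ : 0 < τ.im) :
    Summable fun m : ℤ => cexp (2 * Real.pi * I * τ * ((m : ℂ) + 1 / 2) ^ 2) := by
  have h := ((summable_jacobiTheta₂_term_iff τ (2 * τ)).mpr (by simpa using hτ)).mul_left
    (cexp (Real.pi * I * τ / 2))
  refine h.congr fun m => ?_
  rw [jacobiTheta₂_term, ← Complex.exp_add]; congr 1; ring

lemma landen3 (τ : ℂ) (hτ : 0 < τ.im) : th3 τ ^ 2 = theta3 τ ^ 2 + theta2 τ ^ 2 := by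
  have hτ2 : 0 < (τ / 2).im := by simpa using hτ
  rw [sq, sq, sq]
  refine sq_split (summable_theta3 _ hτ2) (summable_theta3 _ hτ2) (summable_theta3 _ hτ)
    (summable_theta3 _ hτ) (summable_theta2 _ hτ) (summable_theta2 _ hτ) ?_ ?_ <;>
  · intro m n
    rw [← Complex.exp_add, ← Complex.exp_add]; congr 1; push_cast; ring

lemma landen2 (τ : ℂ) (hτ : 0 < τ.im) : th2 τ ^ 2 = 2 * theta2 τ * theta3 τ := by
  have hτ2 : 0 < (τ / 2).im := by simpa using hτ
  have hsh : theta3 τ = ∑' m : ℤ, cexp (2 * Real.pi * I * τ * ((m : ℂ) + 1) ^ 2) := by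
    rw [theta3, ← (Equiv.addRight (1 : ℤ)).tsum_eq]
    simp
  have hshs : Summable fun m : ℤ => cexp (2 * Real.pi * I * τ * ((m : ℂ) + 1) ^ 2) := by
    have := (Equiv.addRight (1 : ℤ)).summable_iff.mpr (summable_theta3 τ hτ)
    refine this.congr fun m => ?_
    simp
  have key : th2 τ * th2 τ = theta2 τ * theta3 τ +
      (∑' m : ℤ, cexp (2 * Real.pi * I * τ * ((m : ℂ) + 1) ^ 2)) * theta2 τ := by
    refine sq_split (summable_theta2 _ hτ2) (summable_theta2 _ hτ2) (summable_theta2 _ hτ)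
      (summable_theta3 _ hτ) hshs (summable_theta2 _ hτ) ?_ ?_ <;>
    · intro m n
      rw [← Complex.exp_add, ← Complex.exp_add]; congr 1; push_cast; ring
  rw [← hsh] at key
  rw [sq, key]; ring

lemma landen4 (τ : ℂ) (hτ : 0 < τ.im) : th4 τ ^ 2 = theta3 τ ^ 2 - theta2 τ ^ 2 := by
  rw [th4, landen3 _ (by simpa using hτ), theta3_add_one, theta2_add_one, mul_pow, I_sq]; ring

lemma jacobi_quartic (T : ℂ) (hT : 0 < T.im) : th3 T ^ 4 = th2 T ^ 4 + th4 T ^ 4 := by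
  have h2 := landen2 T hT
  have h3 := landen3 T hT
  have h4 := landen4 T hT
  rw [show th3 T ^ 4 = (th3 T ^ 2) ^ 2 by ring, show th2 T ^ 4 = (th2 T ^ 2) ^ 2 by ring,
    show th4 T ^ 4 = (th4 T ^ 2) ^ 2 by ring, h2, h3, h4]
  ring

end Theta


section Limits
open Filter Topology

/-- The upper half plane as a set of complex numbers. -/
abbrev UH : Set ℂ := {z | 0 < z.im}

lemma UH_open : IsOpen UH := isOpen_lt continuous_const Complex.continuous_im

lemma UH_conn : IsPreconnected UH := (convex_halfSpace_im_gt 0).isPreconnected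

instance imInf_neBot : NeBot imInf := by
  rw [comap_neBot_iff]
  intro t ht
  obtain ⟨a, ha⟩ := mem_atTop_sets.mp ht
  exact ⟨⟨0, a⟩, ha a le_rfl⟩

lemma ev_UH : ∀ᶠ z in imInf, 0 < z.im :=
  tendsto_comap.eventually (eventually_gt_atTop 0)

lemma factor_zero {f g : ℂ → ℂ} (hf : DifferentiableOn ℂ f UH)
    (h : ∀ z ∈ UH, f z * g z = 0) {c : ℂ} (hc : c ≠ 0) (hgc : Tendsto g imInf (𝓝 c)) :
    ∀ z ∈ UH, f z = 0 := by
  have h1 : ∀ᶠ z in imInf, g z ≠ 0 := hgc.eventually_ne hc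
  obtain ⟨t, ht, hts⟩ := mem_comap.mp h1
  obtain ⟨R, hR⟩ := mem_atTop_sets.mp ht
  have hA : AnalyticOnNhd ℂ f UH := hf.analyticOnNhd UH_open
  let w : ℂ := ⟨0, |R| + 1⟩
  have hw : w ∈ UH := by
    change 0 < |R| + 1
    positivity
  have hev : f =ᶠ[𝓝 w] 0 := by
    have : {z : ℂ | |R| < z.im} ∈ 𝓝 w :=
      (isOpen_lt continuous_const Complex.continuous_im).mem_nhds (by
        change |R| < |R| + 1
        linarith)
    filter_upwards [this] with z hz
    have hz' : |R| < z.im := hz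
    have hgz : g z ≠ 0 := hts (hR _ ((le_abs_self R).trans hz'.le))
    have := h z (show 0 < z.im from (abs_nonneg R).trans_lt hz')
    simpa [hgz] using this
  exact hA.eqOn_zero_of_preconnected_of_eventuallyEq_zero UH_conn hw hev

lemma tendsto_qq : Tendsto qq imInf (𝓝 0) := by
  rw [tendsto_zero_iff_norm_tendsto_zero]
  have h : ∀ τ, ‖qq τ‖ = Real.exp (-(2 * Real.pi * τ.im)) := by
    intro τ
    rw [qq, Complex.norm_exp]; congr 1
    simp
  simp only [h]
  apply Real.tendsto_exp_neg_atTop_nhds_zero.comp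
  exact tendsto_comap.const_mul_atTop Real.two_pi_pos

lemma norm_qq_lt (τ : ℂ) (hτ : 0 < τ.im) : ‖qq τ‖ < 1 := by
  rw [qq, Complex.norm_exp]
  simp
  positivity

lemma qq_ne (τ : ℂ) : qq τ ≠ 0 := Complex.exp_ne_zero _

lemma qq_two (τ : ℂ) : qq (2 * τ) = qq τ ^ 2 := by
  rw [qq, qq, ← Complex.exp_nat_mul]; congr 1; push_cast; ring

lemma tendsto_shift (r : ℝ) (hr : 0 < r) (s : ℂ) :
    Tendsto (fun T : ℂ => (r : ℂ) * T + s) imInf imInf := by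
  rw [tendsto_comap_iff]
  have : (Complex.im ∘ fun T : ℂ => (r : ℂ) * T + s) = fun T => r * T.im + s.im := by
    ext T; simp
  rw [this]
  exact tendsto_atTop_add_const_right _ _ (tendsto_comap.const_mul_atTop hr)

lemma tendsto_th3 : Tendsto th3 imInf (𝓝 1) := by
  have h := isBigO_at_im_infty_jacobiTheta_sub_one
  have h2 : Tendsto (fun τ : ℂ => Real.exp (-Real.pi * τ.im)) imInf (𝓝 0) := by
    have := Real.tendsto_exp_neg_atTop_nhds_zero.comp
      ((tendsto_comap (f := Complex.im) (x := atTop)).const_mul_atTop Real.pi_pos)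
    refine this.congr fun τ => ?_
    simp
  have h3 := (h.trans_tendsto h2).add_const 1
  simp only [sub_add_cancel, zero_add] at h3
  refine h3.congr fun τ => ?_
  rw [th3_eq, jacobiTheta_eq_jacobiTheta₂]

lemma tendsto_th4 : Tendsto th4 imInf (𝓝 1) := by
  have := tendsto_th3.comp (tendsto_shift 1 one_pos 1)
  refine this.congr fun T => ?_
  simp [th4]

lemma tendsto_th2_aux : Tendsto (fun T : ℂ => jacobiTheta₂ (T / 2) T) imInf (𝓝 2) := by
  have hb : Summable fun n : ℤ => ‖jacobiTheta₂_term n (I / 2) I‖ :=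
    ((summable_jacobiTheta₂_term_iff (I / 2) I).mpr (by simp)).norm
  have hform (n : ℤ) (T : ℂ) : ‖jacobiTheta₂_term n (T / 2) T‖ =
      Real.exp (-((Real.pi * (n * (n + 1) : ℤ)) * T.im)) := by
    rw [norm_jacobiTheta₂_term]; congr 1
    simp
    ring
  have hnn (n : ℤ) : 0 ≤ n * (n + 1) := by
    rcases le_or_gt 0 n with h | h
    · positivity
    · nlinarith
  have hlim := tendsto_tsum_of_dominated_convergence (𝓕 := imInf)
    (f := fun T n => jacobiTheta₂_term n (T / 2) T)
    (g := fun n : ℤ => if n ∈ ({0, -1} : Finset ℤ) then (1 : ℂ) else 0) hb ?_ ?_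
  · rw [tsum_eq_sum (s := ({0, -1} : Finset ℤ))] at hlim
    · have e : ∑ b ∈ ({0, -1} : Finset ℤ), (if b ∈ ({0, -1} : Finset ℤ) then (1 : ℂ) else 0) = 2 := by
        rw [Finset.sum_congr rfl (fun b hb => if_pos hb)]
        norm_num
      rw [e] at hlim
      exact hlim
    · intro b hb
      simp [hb]
  · intro n
    by_cases hn : n ∈ ({0, -1} : Finset ℤ)
    · rw [if_pos hn]
      refine tendsto_const_nhds.congr fun T => ?_
      simp only [Finset.mem_insert, Finset.mem_singleton] at hn
      rcases hn with rfl | rfl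
      · simp [jacobiTheta₂_term]
      · rw [jacobiTheta₂_term, eq_comm, ← Complex.exp_zero]
        congr 1
        push_cast; ring
    · rw [if_neg hn, tendsto_zero_iff_norm_tendsto_zero]
      simp only [hform]
      apply Real.tendsto_exp_neg_atTop_nhds_zero.comp
      refine tendsto_comap.const_mul_atTop ?_
      have : 0 < n * (n + 1) := by
        refine lt_of_le_of_ne (hnn n) ?_
        intro h0
        apply hn
        rcases mul_eq_zero.mp h0.symm with h | h
        · simp [h]
        · simp [show n = -1 by omega]
      have h' : (0 : ℝ) < (n * (n + 1) : ℤ) := by exact_mod_cast this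
      exact mul_pos Real.pi_pos h'
  · have : ∀ᶠ T : ℂ in imInf, 1 ≤ T.im := tendsto_comap.eventually (eventually_ge_atTop 1)
    filter_upwards [this] with T hT n
    rw [hform, hform]
    apply Real.exp_le_exp.mpr
    have h' : (0 : ℝ) ≤ (n * (n + 1) : ℤ) := by exact_mod_cast hnn n
    have h2 : 0 ≤ Real.pi * (n * (n + 1) : ℤ) := mul_nonneg Real.pi_pos.le h'
    simp only [I_im, mul_one]
    nlinarith

lemma th2_pow8 (T : ℂ) : th2 T ^ 8 = qq T * jacobiTheta₂ (T / 2) T ^ 8 := by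
  rw [th2_eq, mul_pow, ← Complex.exp_nat_mul, qq]
  congr 2; push_cast; ring

lemma th2_pow4 (T : ℂ) : th2 (2 * T) ^ 4 = qq T * jacobiTheta₂ T (2 * T) ^ 4 := by
  rw [th2_eq, mul_pow, ← Complex.exp_nat_mul, qq]
  congr 2
  · push_cast; ring
  · congr 1; ring

/-- The Euler product. -/
def eulP (x : ℂ) : ℂ := ∏' n : ℕ, (1 - x ^ (n + 1))

lemma eulP_diff : DifferentiableOn ℂ eulP (Metric.ball 0 1) :=
  ModularForm.differentiableOn_tprod_one_sub_pow

lemma eulP_zero : eulP 0 = 1 := by simp [eulP]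

lemma eta_eulP (τ : ℂ) : dedekindEta τ = cexp (Real.pi * I * τ / 12) * eulP (qq τ) := rfl

lemma eta_eq (τ : ℂ) : ModularForm.eta τ = dedekindEta τ := by
  rw [ModularForm.eta, dedekindEta, Function.Periodic.qParam]
  congr 1
  · congr 1; push_cast; ring
  · refine tprod_congr fun n => ?_
    rw [ModularForm.eta_q_eq_pow]; rfl

lemma eta_ne (τ : ℂ) (hτ : 0 < τ.im) : dedekindEta τ ≠ 0 := by
  rw [← eta_eq]; exact ModularForm.eta_ne_zero hτ

lemma eulP_qq_ne (τ : ℂ) (hτ : 0 < τ.im) : eulP (qq τ) ≠ 0 := by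
  have := eta_ne τ hτ
  rw [eta_eulP] at this
  exact right_ne_zero_of_mul this

lemma eta_diff : DifferentiableOn ℂ dedekindEta UH := by
  have : dedekindEta = ModularForm.eta := funext fun τ => (eta_eq τ).symm
  rw [this]
  exact fun z hz =>
    (ModularForm.differentiableAt_eta_of_mem_upperHalfPlaneSet hz).differentiableWithinAt

lemma tendsto_eulP : Tendsto eulP (𝓝 0) (𝓝 1) := by
  have := (eulP_diff.differentiableAt (Metric.ball_mem_nhds 0 one_pos)).continuousAt.tendsto
  rwa [eulP_zero] at this

lemma eta_pow24 (τ : ℂ) : dedekindEta τ ^ 24 = qq τ * eulP (qq τ) ^ 24 := by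
  rw [eta_eulP, mul_pow, ← Complex.exp_nat_mul, qq]
  congr 2; push_cast; ring

lemma theta3_diff : DifferentiableOn ℂ theta3 UH := by
  intro τ hτ
  have h : theta3 = fun τ => jacobiTheta₂ 0 (2 * τ) := funext theta3_eq
  rw [h]
  have h2 : 0 < (2 * τ).im := by simpa using hτ
  exact ((differentiableAt_jacobiTheta₂_snd 0 h2).comp τ
    (by fun_prop : DifferentiableAt ℂ (fun τ : ℂ => 2 * τ) τ)).differentiableWithinAt

lemma theta2_diff : DifferentiableOn ℂ theta2 UH := by
  intro τ hτ
  have h : theta2 = fun τ => cexp (Real.pi * I * τ / 2) * jacobiTheta₂ τ (2 * τ) :=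
    funext theta2_eq
  rw [h]
  have h2 : 0 < (2 * τ).im := by simpa using hτ
  have h3 := (hasFDerivAt_jacobiTheta₂ τ h2).differentiableAt
  have h4 : DifferentiableAt ℂ (fun t : ℂ => jacobiTheta₂ t (2 * t)) τ :=
    DifferentiableAt.comp τ (f := fun t : ℂ => ((t, 2 * t) : ℂ × ℂ)) h3 (by fun_prop)
  exact (DifferentiableAt.mul (by fun_prop) h4).differentiableWithinAt

lemma diff_comp_affine {f : ℂ → ℂ} (hf : DifferentiableOn ℂ f UH) (r : ℝ) (hr : 0 < r) (s : ℝ) :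
    DifferentiableOn ℂ (fun z => f (r * z + s)) UH := by
  apply hf.comp (by fun_prop)
  intro z hz
  change 0 < (r * z + s : ℂ).im
  simpa using mul_pos hr hz

lemma th3_diff : DifferentiableOn ℂ th3 UH := by
  refine (diff_comp_affine theta3_diff (1 / 2) (by norm_num) 0).congr fun z _ => ?_
  rw [th3]; congr 1; push_cast; ring

lemma th2_diff : DifferentiableOn ℂ th2 UH := by
  refine (diff_comp_affine theta2_diff (1 / 2) (by norm_num) 0).congr fun z _ => ?_
  rw [th2]; congr 1; push_cast; ring

lemma th4_diff : DifferentiableOn ℂ th4 UH := by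
  refine (diff_comp_affine th3_diff 1 (by norm_num) 1).congr fun z _ => ?_
  rw [th4]; congr 1; push_cast; ring

/-- `(θ₂θ₃θ₄)⁸ = 256 η²⁴`. -/
lemma theta_prod (T : ℂ) (hT : 0 < T.im) :
    (th2 T * th3 T * th4 T) ^ 8 = 256 * dedekindEta T ^ 24 := by
  have hq : Tendsto (fun T => (th2 T * th3 T * th4 T) ^ 8 / qq T) imInf (𝓝 256) := by
    have h := ((tendsto_th2_aux.mul tendsto_th3).mul tendsto_th4).pow 8
    norm_num at h
    refine h.congr fun T => ?_
    rw [mul_pow (th2 T * th3 T), mul_pow (th2 T), th2_pow8]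
    have := qq_ne T
    field_simp
  obtain ⟨c, hc⟩ := levelOne_twelve (fun T => (th2 T * th3 T * th4 T) ^ 8)
    (((th2_diff.mul th3_diff).mul th4_diff).pow 8)
    (fun z _ => by
      simp only [mul_pow, th2_add_one, th4_add_one]
      rw [show th3 (z + 1) = th4 z from rfl]; ring)
    (fun z hz => by
      simp only [mul_pow, th3_S z hz, th4_S' z hz, th2_S' z hz]
      rw [show (12 : ℤ) = ((12 : ℕ) : ℤ) by norm_num, zpow_natCast]
      ring)
    (by
      have := hq.mul tendsto_qq
      rw [mul_zero] at this
      refine this.congr fun T => ?_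
      rw [div_mul_cancel₀ _ (qq_ne T)])
  have hlim2 : Tendsto (fun T => (th2 T * th3 T * th4 T) ^ 8 / qq T) imInf (𝓝 c) := by
    have h := ((tendsto_eulP.comp tendsto_qq).pow 24).const_mul c
    rw [one_pow, mul_one] at h
    refine h.congr' ?_
    filter_upwards [ev_UH] with T hT
    have := hc T hT
    rw [this, eta_eq, eta_pow24]
    have := qq_ne T
    simp only [Function.comp]
    field_simp
  have := hc T hT
  rw [this, eta_eq, tendsto_nhds_unique hlim2 hq]

lemma th_rel (τ : ℂ) (hτ : 0 < τ.im) :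
    theta2 τ ^ 4 * theta3 τ ^ 4 * th4 (2 * τ) ^ 16 = 16 * dedekindEta τ ^ 24 ∧
    (theta2 τ * theta3 τ * th4 (2 * τ)) ^ 8 = 256 * dedekindEta (2 * τ) ^ 24 ∧
    theta3 τ ^ 4 = theta2 τ ^ 4 + th4 (2 * τ) ^ 4 := by
  have e2 : th2 (2 * τ) = theta2 τ := by rw [th2]; congr 1; ring
  have e3 : th3 (2 * τ) = theta3 τ := by rw [th3]; congr 1; ring
  have h2 : 0 < (2 * τ).im := by simpa using hτ
  have hA := theta_prod τ hτ
  have hB := theta_prod (2 * τ) h2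
  have hJ := jacobi_quartic (2 * τ) h2
  rw [e2, e3] at hB hJ
  have l2 := landen2 τ hτ
  have l3 := landen3 τ hτ
  have l4 := landen4 τ hτ
  refine ⟨?_, hB, hJ⟩
  have hm : th3 τ ^ 2 * th4 τ ^ 2 = th4 (2 * τ) ^ 4 := by
    rw [l3, l4]; linear_combination hJ
  have : (th2 τ * th3 τ * th4 τ) ^ 8 = (th2 τ ^ 2) ^ 4 * (th3 τ ^ 2 * th4 τ ^ 2) ^ 4 := by ring
  rw [this, hm, l2] at hA
  linear_combination hA / 16

lemma gauss4 (τ : ℂ) (hτ : 0 < τ.im) :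
    th4 (2 * τ) ^ 8 * dedekindEta (2 * τ) ^ 8 = dedekindEta τ ^ 16 := by
  have hcube (τ : ℂ) (hτ : 0 < τ.im) :
      (th4 (2 * τ) ^ 8 * dedekindEta (2 * τ) ^ 8) ^ 3 = (dedekindEta τ ^ 16) ^ 3 := by
    obtain ⟨h1, h2, -⟩ := th_rel τ hτ
    have := congrArg (· ^ 2) h1
    linear_combination -(th4 (2 * τ) ^ 24) * h2 / 256 + this / 256
  have d2 : DifferentiableOn ℂ (fun τ => dedekindEta (2 * τ)) UH :=
    (diff_comp_affine eta_diff 2 two_pos 0).congr fun z _ => by push_cast; rw [add_zero]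
  have d4 : DifferentiableOn ℂ (fun τ => th4 (2 * τ)) UH :=
    (diff_comp_affine th4_diff 2 two_pos 0).congr fun z _ => by push_cast; rw [add_zero]
  let f : ℂ → ℂ := fun τ => th4 (2 * τ) ^ 8 * dedekindEta (2 * τ) ^ 8 / dedekindEta τ ^ 16
  have hfd : DifferentiableOn ℂ f UH :=
    ((d4.pow 8).mul (d2.pow 8)).div (eta_diff.pow 16) fun z hz => pow_ne_zero _ (eta_ne z hz)
  have hf1 : Tendsto f imInf (𝓝 1) := by
    have hs := tendsto_shift 2 two_pos 0
    have h4 := (tendsto_th4.comp hs).pow 8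
    have hP := (tendsto_eulP.comp tendsto_qq)
    have hP2 := (hP.comp hs).pow 8
    have := (h4.mul hP2).div (hP.pow 16) (by norm_num)
    norm_num at this
    refine this.congr fun τ => ?_
    simp only [f, Function.comp, Pi.div_apply]
    rw [eta_eulP, eta_eulP, mul_pow, mul_pow, ← Complex.exp_nat_mul, ← Complex.exp_nat_mul]
    rw [show ((8 : ℕ) : ℂ) * (Real.pi * I * (2 * τ) / 12) = (16 : ℕ) * (Real.pi * I * τ / 12) by
      push_cast; ring]
    have := Complex.exp_ne_zero ((16 : ℕ) * (Real.pi * I * τ / 12))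
    field_simp
  have hz := factor_zero (f := fun τ => f τ - 1) (g := fun τ => f τ ^ 2 + f τ + 1)
    (hfd.sub_const 1) (fun z hz => by
      have h3 : f z ^ 3 = 1 := by
        simp only [f]
        rw [div_pow, hcube z hz, div_self]
        exact pow_ne_zero _ (pow_ne_zero _ (eta_ne z hz))
      linear_combination h3) (c := 3) (by norm_num) (by
      have := ((hf1.pow 2).add hf1).add_const 1
      norm_num at this
      exact this)
  have h := sub_eq_zero.mp (hz τ hτ)
  simp only [f] at h
  exact (div_eq_one_iff_eq (pow_ne_zero _ (eta_ne τ hτ))).mp h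

lemma gauss23 (τ : ℂ) (hτ : 0 < τ.im) :
    theta2 τ ^ 4 * theta3 τ ^ 4 * dedekindEta τ ^ 8 = 16 * dedekindEta (2 * τ) ^ 16 := by
  obtain ⟨h1, -, -⟩ := th_rel τ hτ
  have h4 := gauss4 τ hτ
  have ha := pow_ne_zero 24 (eta_ne τ hτ)
  apply mul_left_cancel₀ ha
  have h5 := congrArg (· ^ 2) h4
  linear_combination dedekindEta (2 * τ) ^ 16 * h1 - theta2 τ ^ 4 * theta3 τ ^ 4 * h5

end Limits


section Eisen
open Filter Topology

/-- `2πi`. -/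
abbrev cc : ℂ := 2 * Real.pi * I

lemma cc_ne : cc ≠ 0 := Complex.two_pi_I_ne_zero

/-- The normalised logarithmic derivative of `η²⁴`. -/
def Ef (τ : ℂ) : ℂ := 24 * (cc⁻¹ * (deriv dedekindEta τ / dedekindEta τ))

lemma eta_hasDeriv (τ : ℂ) (hτ : 0 < τ.im) :
    HasDerivAt dedekindEta (cc / 24 * Ef τ * dedekindEta τ) τ := by
  have h := (eta_diff.differentiableAt (UH_open.mem_nhds hτ)).hasDerivAt
  have e : deriv dedekindEta τ = cc / 24 * Ef τ * dedekindEta τ := by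
    have := eta_ne τ hτ
    have := cc_ne
    simp only [Ef]
    field_simp
  rwa [e] at h

lemma qq_hasDeriv (τ : ℂ) : HasDerivAt qq (cc * qq τ) τ := by
  have h : HasDerivAt (fun t : ℂ => 2 * Real.pi * I * t) (2 * Real.pi * I) τ := by
    simpa using (hasDerivAt_id τ).const_mul (2 * Real.pi * I : ℂ)
  have h2 := h.cexp
  rw [mul_comm (cexp _)] at h2
  exact h2

lemma qq_ball (τ : ℂ) (hτ : 0 < τ.im) : qq τ ∈ Metric.ball (0 : ℂ) 1 := by
  simpa using norm_qq_lt τ hτ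

/-- `Ef` in the variable `q`. -/
def phi (x : ℂ) : ℂ := 1 + 24 * (x * deriv eulP x / eulP x)

lemma eulP_diff' : DifferentiableOn ℂ (deriv eulP) (Metric.ball 0 1) :=
  eulP_diff.deriv Metric.isOpen_ball

lemma phi_diffAt (x : ℂ) (hx : x ∈ Metric.ball (0 : ℂ) 1) (h0 : eulP x ≠ 0) :
    DifferentiableAt ℂ phi x := by
  have h1 := eulP_diff.differentiableAt (Metric.isOpen_ball.mem_nhds hx)
  have h2 := eulP_diff'.differentiableAt (Metric.isOpen_ball.mem_nhds hx)
  exact (((differentiableAt_id.mul h2).div h1 h0).const_mul 24).const_add 1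

lemma Ef_phi (τ : ℂ) (hτ : 0 < τ.im) : Ef τ = phi (qq τ) := by
  have h1 := eta_hasDeriv τ hτ
  have hP := (eulP_diff.differentiableAt
    (Metric.isOpen_ball.mem_nhds (qq_ball τ hτ))).hasDerivAt
  have h2 : HasDerivAt (fun t => eulP (qq t)) _ τ := hP.comp τ (qq_hasDeriv τ)
  have h : HasDerivAt (fun t : ℂ => Real.pi * I * t / 12) (Real.pi * I / 12) τ := by
    simpa using ((hasDerivAt_id τ).const_mul (Real.pi * I : ℂ)).div_const 12
  have h3 := h.cexp.mul h2
  have h4 := h1.unique h3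
  rw [eta_eulP] at h4
  have e0 := eulP_qq_ne τ hτ
  have e1 := Complex.exp_ne_zero (Real.pi * I * τ / 12)
  have e2 := cc_ne
  have h5 : cc * (Ef τ * eulP (qq τ)) =
      cc * (eulP (qq τ) + 24 * (qq τ * deriv eulP (qq τ))) := by
    apply mul_left_cancel₀ e1
    simp only [cc] at h4 ⊢
    linear_combination 24 * h4
  have h6 := mul_left_cancel₀ e2 h5
  rw [phi]
  field_simp
  linear_combination h6

lemma eulP_ev : ∀ᶠ x in 𝓝 (0 : ℂ), eulP x ≠ 0 := tendsto_eulP.eventually_ne one_ne_zero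

lemma phi_zero : phi 0 = 1 := by simp [phi]

lemma phi_analytic : AnalyticAt ℂ phi 0 := by
  rw [Complex.analyticAt_iff_eventually_differentiableAt]
  filter_upwards [eulP_ev, Metric.ball_mem_nhds (0 : ℂ) one_pos] with x h1 h2
  exact phi_diffAt x h2 h1

lemma tendsto_Ef : Tendsto Ef imInf (𝓝 1) := by
  have := phi_analytic.continuousAt.tendsto.comp tendsto_qq
  rw [phi_zero] at this
  refine this.congr' ?_
  filter_upwards [ev_UH] with τ hτ
  exact (Ef_phi τ hτ).symm

lemma Ef_hasDeriv' (τ : ℂ) (hτ : 0 < τ.im) :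
    HasDerivAt Ef (deriv phi (qq τ) * (cc * qq τ)) τ := by
  have h1 := (phi_diffAt _ (qq_ball τ hτ) (eulP_qq_ne τ hτ)).hasDerivAt.comp τ (qq_hasDeriv τ)
  refine h1.congr_of_eventuallyEq ?_
  filter_upwards [UH_open.mem_nhds hτ] with t ht
  exact Ef_phi t ht

lemma Ef_hasDeriv (τ : ℂ) (hτ : 0 < τ.im) : HasDerivAt Ef (cc * dq Ef τ) τ := by
  have h := Ef_hasDeriv' τ hτ
  convert h using 1
  rw [dq, h.deriv]
  have := cc_ne
  simp only [cc] at *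
  field_simp

lemma dq_Ef (τ : ℂ) (hτ : 0 < τ.im) : dq Ef τ = deriv phi (qq τ) * qq τ := by
  rw [dq, (Ef_hasDeriv' τ hτ).deriv]
  have := cc_ne
  simp only [cc] at *
  field_simp

lemma tendsto_dq_Ef : Tendsto (dq Ef) imInf (𝓝 0) := by
  have := (phi_analytic.deriv.continuousAt.tendsto.comp tendsto_qq).mul tendsto_qq
  rw [mul_zero] at this
  refine this.congr' ?_
  filter_upwards [ev_UH] with τ hτ
  exact (dq_Ef τ hτ).symm

lemma qq_add_one (τ : ℂ) : qq (τ + 1) = qq τ := by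
  rw [qq, qq, mul_add, mul_one, Complex.exp_add, Complex.exp_two_pi_mul_I, mul_one]

lemma Ef_add_one (τ : ℂ) (hτ : 0 < τ.im) : Ef (τ + 1) = Ef τ := by
  rw [Ef_phi τ hτ, Ef_phi _ (by simpa using hτ), qq_add_one]

lemma dq_Ef_add_one (τ : ℂ) (hτ : 0 < τ.im) : dq Ef (τ + 1) = dq Ef τ := by
  rw [dq_Ef τ hτ, dq_Ef _ (by simpa using hτ), qq_add_one]

lemma neg_inv_hasDeriv (z : ℂ) (hz : z ≠ 0) : HasDerivAt (fun z : ℂ => -1 / z) (1 / z ^ 2) z := by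
  have h := (hasDerivAt_inv hz).neg
  have e : (-fun y : ℂ => y⁻¹) = fun z : ℂ => -1 / z := by
    funext t
    change -t⁻¹ = -1 / t
    rw [neg_div, one_div]
  rw [e, neg_neg, ← one_div] at h
  exact h

lemma UH_ne {z : ℂ} (hz : 0 < z.im) : z ≠ 0 := by
  rintro rfl; simp at hz

lemma Ef_S (z : ℂ) (hz : 0 < z.im) : Ef (-1 / z) = z ^ 2 * Ef z + 12 * z / cc := by
  have hw := im_neg_inv_pos z hz
  have z0 := UH_ne hz
  have h1 : HasDerivAt (fun z => dedekindEta (-1 / z) ^ 8) _ z :=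
    ((eta_hasDeriv (-1 / z) hw).comp z (neg_inv_hasDeriv z z0)).pow 8
  have h2 : HasDerivAt (fun z => z ^ 4 * dedekindEta z ^ 8) _ z :=
    (hasDerivAt_pow 4 z).mul ((eta_hasDeriv z hz).pow 8)
  have h3 := h2.congr_of_eventuallyEq (f₁ := fun z => dedekindEta (-1 / z) ^ 8) (by
    filter_upwards [UH_open.mem_nhds hz] with t ht
    rw [← eta_eq, ← eta_eq, eta_S_pow8 t ht])
  have h4 := h1.unique h3
  have h5 : dedekindEta (-1 / z) ^ 8 = z ^ 4 * dedekindEta z ^ 8 := by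
    rw [← eta_eq, ← eta_eq, eta_S_pow8 z hz]
  simp only [Function.comp] at h4
  have h6 : dedekindEta (-1 / z) ^ 8 * (cc / 3 * Ef (-1 / z) / z ^ 2) =
      4 * z ^ 3 * dedekindEta z ^ 8 + z ^ 4 * dedekindEta z ^ 8 * (cc / 3 * Ef z) := by
    push_cast at h4
    norm_num at h4
    linear_combination h4
  rw [h5] at h6
  have c0 := cc_ne
  have e0 := pow_ne_zero 8 (eta_ne z hz)
  generalize cc = c at *
  generalize Ef (-1 / z) = u at *
  generalize dedekindEta z ^ 8 = v at *
  field_simp at h6 ⊢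
  linear_combination h6

lemma dq_Ef_S (z : ℂ) (hz : 0 < z.im) :
    dq Ef (-1 / z) = z ^ 2 * (2 * z * Ef z / cc + z ^ 2 * dq Ef z + 12 / cc ^ 2) := by
  have hw := im_neg_inv_pos z hz
  have z0 := UH_ne hz
  have h1 : HasDerivAt (fun z => Ef (-1 / z)) _ z :=
    (Ef_hasDeriv (-1 / z) hw).comp z (neg_inv_hasDeriv z z0)
  have h2 : HasDerivAt (fun z => z ^ 2 * Ef z + 12 * z / cc) _ z :=
    ((hasDerivAt_pow 2 z).mul (Ef_hasDeriv z hz)).add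
      (((hasDerivAt_id z).const_mul 12).div_const cc)
  have h3 := h2.congr_of_eventuallyEq (f₁ := fun z => Ef (-1 / z)) (by
    filter_upwards [UH_open.mem_nhds hz] with t ht
    exact Ef_S t ht)
  have h4 := h1.unique h3
  have c0 := cc_ne
  norm_num at h4
  generalize dq Ef (-1 / z) = u at *
  generalize dq Ef z = v at *
  simp only [cc] at *
  generalize (2 * Real.pi * I : ℂ) = c at *
  field_simp at h4 ⊢
  linear_combination h4

lemma dq_Ef_diff : DifferentiableOn ℂ (dq Ef) UH := by
  have h : DifferentiableOn ℂ Ef UH := fun z hz =>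
    (Ef_hasDeriv z hz).differentiableAt.differentiableWithinAt
  exact (h.deriv UH_open).const_mul _

lemma tendsto_th2_pow8 : Tendsto (fun T => th2 T ^ 8) imInf (𝓝 0) := by
  have := tendsto_qq.mul (tendsto_th2_aux.pow 8)
  rw [zero_mul] at this
  exact this.congr fun T => (th2_pow8 T).symm

/-- The Ramanujan identity for the derivative of the weight two Eisenstein series. -/
lemma ramanujan (z : ℂ) (hz : 0 < z.im) :
    12 * dq Ef z = Ef z ^ 2 - (th2 z ^ 8 + th3 z ^ 8 + th4 z ^ 8) / 2 := by
  have hE : DifferentiableOn ℂ Ef UH := fun z hz =>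
    (Ef_hasDeriv z hz).differentiableAt.differentiableWithinAt
  have := levelOne_eq_zero (fun z => (th2 z ^ 8 + th3 z ^ 8 + th4 z ^ 8) / 2 + 12 * dq Ef z
      - Ef z ^ 2) 4 (by norm_num)
    ((((((th2_diff.pow 8).add (th3_diff.pow 8)).add (th4_diff.pow 8)).div_const 2).add
      (dq_Ef_diff.const_mul 12)).sub (hE.pow 2))
    (fun z hz => by
      simp only [th2_add_one, th4_add_one, Ef_add_one z hz, dq_Ef_add_one z hz]
      rw [show th3 (z + 1) = th4 z from rfl]; ring)
    (fun z hz => by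
      simp only [th3_S z hz, th4_S' z hz, th2_S' z hz, Ef_S z hz, dq_Ef_S z hz]
      rw [show (4 : ℤ) = ((4 : ℕ) : ℤ) by norm_num, zpow_natCast]
      have := cc_ne
      generalize cc = c at *
      field_simp
      ring)
    (by
      have h := (((((tendsto_th2_pow8).add (tendsto_th3.pow 8)).add (tendsto_th4.pow 8)).div_const
        2).add (tendsto_dq_Ef.const_mul 12)).sub (tendsto_Ef.pow 2)
      norm_num at h
      exact h) z hz
  linear_combination this

lemma Ef_EisE2 (τ : ℂ) (hτ : 0 < τ.im) : Ef τ = EisE2 (qq τ) := by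
  have h := ModularForm.logDeriv_eta_eq_E2 ⟨τ, hτ⟩
  rw [EisensteinSeries.E2_eq_tsum_cexp] at h
  have he : ModularForm.eta = dedekindEta := funext eta_eq
  rw [he] at h
  rw [logDeriv_apply] at h
  change deriv dedekindEta τ / dedekindEta τ = _ at h
  rw [Ef, h, EisE2]
  simp only [UpperHalfPlane.coe_mk]
  rw [tsum_pnat_eq_tsum_succ (f := fun n : ℕ => (ArithmeticFunction.sigma 1 n : ℂ) *
    cexp (2 * Real.pi * I * τ) ^ n)]
  have hq : cexp (2 * Real.pi * I * τ) = qq τ := rfl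
  have hs : (∑' n : ℕ, (ArithmeticFunction.sigma 1 (n + 1) : ℂ) *
      cexp (2 * Real.pi * I * τ) ^ (n + 1)) =
      ∑' n : ℕ, (∑ d ∈ (n + 1).divisors, (d : ℂ)) * qq τ ^ (n + 1) := by
    refine tsum_congr fun n => ?_
    rw [hq, ArithmeticFunction.sigma_one_apply]
    push_cast; rfl
  rw [hs]
  have := Complex.two_pi_I_ne_zero
  have hp : (Real.pi : ℂ) ≠ 0 := by exact_mod_cast Real.pi_ne_zero
  simp only [cc]
  field_simp
  norm_num

lemma summ_sigma (τ : ℂ) (hτ : 0 < τ.im) :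
    Summable fun n : ℕ => (∑ d ∈ (n + 1).divisors, (d : ℂ)) * qq τ ^ (n + 1) := by
  have h := EisensteinSeries.hasSum_qExpansion_E2 (z := ⟨τ, hτ⟩)
  have h2 := ((summable_nat_add_iff 1).mpr h.summable).mul_left (-1 / 24)
  refine h2.congr fun n => ?_
  have hq : cexp (2 * Real.pi * I * τ) = qq τ := rfl
  simp only [UpperHalfPlane.coe_mk, hq, ArithmeticFunction.sigma_one_apply]
  rw [if_neg (by omega)]
  push_cast
  simp only [smul_eq_mul]
  ring

end Eisen


section Final
open Filter Topology

lemma wdiv_split (n : ℕ) : wdiv 1 2 (fun m => if m = 0 then 2 else 1) n =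
    (∑ d ∈ n.divisors, (d : ℂ)) + ∑ d ∈ n.divisors, if d % 2 = 0 then (d : ℂ) else 0 := by
  rw [wdiv, ← Finset.sum_add_distrib]
  refine Finset.sum_congr rfl fun d _ => ?_
  split_ifs <;> ring

lemma even_div_odd (n : ℕ) (hn : n % 2 = 1) :
    (∑ d ∈ n.divisors, if d % 2 = 0 then (d : ℂ) else 0) = 0 := by
  refine Finset.sum_eq_zero fun d hd => ?_
  rw [if_neg]
  intro h
  have h1 := Nat.dvd_of_mem_divisors hd
  have h2 : 2 ∣ n := (Nat.dvd_of_mod_eq_zero h).trans h1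
  omega

lemma even_div_even (k : ℕ) (hk : k ≠ 0) :
    (∑ d ∈ (2 * k).divisors, if d % 2 = 0 then (d : ℂ) else 0) =
      2 * ∑ d ∈ k.divisors, (d : ℂ) := by
  rw [← Finset.sum_filter, Finset.mul_sum]
  symm
  refine Finset.sum_bij' (fun d _ => 2 * d) (fun d _ => d / 2) ?_ ?_ ?_ ?_ ?_
  · intro d hd
    simp only [Finset.mem_filter, Nat.mem_divisors] at hd ⊢
    exact ⟨⟨Nat.mul_dvd_mul_left 2 hd.1, by omega⟩, by omega⟩
  · intro d hd
    simp only [Finset.mem_filter, Nat.mem_divisors] at hd ⊢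
    refine ⟨?_, hk⟩
    obtain ⟨e, rfl⟩ := Nat.dvd_of_mod_eq_zero hd.2
    rw [Nat.mul_div_cancel_left _ two_pos]
    exact Nat.dvd_of_mul_dvd_mul_left two_pos hd.1.1
  · intro d _
    simp
  · intro d hd
    simp only [Finset.mem_filter, Nat.mem_divisors] at hd
    omega
  · intro d _
    push_cast; ring

lemma series_eq (τ : ℂ) (hτ : 0 < τ.im) :
    (1 / 3) * (2 * EisE2 (qq τ ^ 2) + EisE2 (qq τ)) = 1 - 8 * ∑' n : ℕ,
      wdiv 1 2 (fun m => if m = 0 then 2 else 1) (n + 1) * qq τ ^ (n + 1) := by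
  have s1 := summ_sigma τ hτ
  have s2 := summ_sigma (2 * τ) (by simpa using hτ)
  rw [qq_two] at s2
  have hinj : Function.Injective (fun m : ℕ => 2 * m + 1) := fun a b h => by
    simp only at h; omega
  have h2 : HasSum (fun n : ℕ => (∑ d ∈ (n + 1).divisors, if d % 2 = 0 then (d : ℂ) else 0) *
      qq τ ^ (n + 1))
      (2 * ∑' n : ℕ, (∑ d ∈ (n + 1).divisors, (d : ℂ)) * (qq τ ^ 2) ^ (n + 1)) := by
    rw [← hinj.hasSum_iff]
    · refine (s2.hasSum.mul_left 2).congr_fun ?_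
      intro m
      simp only [Function.comp]
      rw [show 2 * m + 1 + 1 = 2 * (m + 1) by ring, even_div_even _ (by omega), pow_mul]
      ring
    · intro n hn
      have : (n + 1) % 2 = 1 := by
        by_contra h
        apply hn
        exact ⟨n / 2, by simp only; omega⟩
      rw [even_div_odd _ this, zero_mul]
  have h3 := (s1.hasSum.add h2).tsum_eq
  have h4 : (∑' n : ℕ, wdiv 1 2 (fun m => if m = 0 then 2 else 1) (n + 1) * qq τ ^ (n + 1)) =
      ∑' n : ℕ, ((∑ d ∈ (n + 1).divisors, (d : ℂ)) * qq τ ^ (n + 1) +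
        (∑ d ∈ (n + 1).divisors, if d % 2 = 0 then (d : ℂ) else 0) * qq τ ^ (n + 1)) := by
    refine tsum_congr fun n => ?_
    rw [wdiv_split]; ring
  rw [h4, h3, EisE2, EisE2]
  ring

/-- `η(τ)¹⁶/η(2τ)⁸`. -/
def Af (τ : ℂ) : ℂ := dedekindEta τ ^ 16 / dedekindEta (2 * τ) ^ 8

/-- `η(2τ)¹⁶/η(τ)⁸`. -/
def Bf (τ : ℂ) : ℂ := dedekindEta (2 * τ) ^ 16 / dedekindEta τ ^ 8

/-- `E₂(2τ)`. -/
def Ff (τ : ℂ) : ℂ := Ef (2 * τ)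

lemma im_two {τ : ℂ} (hτ : 0 < τ.im) : 0 < (2 * τ).im := by simpa using hτ

lemma Yf_eq (τ : ℂ) : Yf τ = Af τ - 64 * Bf τ := by
  rw [Yf, Af, Bf]; ring

lemma Zf_eq (τ : ℂ) (hτ : 0 < τ.im) : Zf τ = 256 * Af τ * Bf τ := by
  have h1 := eta_ne τ hτ
  have h2 := eta_ne _ (im_two hτ)
  rw [Zf, Af, Bf]
  field_simp

lemma Zf_ne (τ : ℂ) (hτ : 0 < τ.im) : Zf τ ≠ 0 :=
  mul_ne_zero (mul_ne_zero (by norm_num) (pow_ne_zero _ (eta_ne τ hτ)))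
    (pow_ne_zero _ (eta_ne _ (im_two hτ)))

lemma Af_theta (τ : ℂ) (hτ : 0 < τ.im) : Af τ = (theta3 τ ^ 4 - theta2 τ ^ 4) ^ 2 := by
  obtain ⟨-, -, h3⟩ := th_rel τ hτ
  rw [Af, ← gauss4 τ hτ, mul_div_cancel_right₀ _ (pow_ne_zero _ (eta_ne _ (im_two hτ))), h3]
  ring

lemma Bf_theta (τ : ℂ) (hτ : 0 < τ.im) : 16 * Bf τ = theta2 τ ^ 4 * theta3 τ ^ 4 := by
  have h := gauss23 τ hτ
  have h1 := pow_ne_zero 8 (eta_ne τ hτ)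
  rw [Bf, mul_div_assoc', ← h, mul_div_cancel_right₀ _ h1]

lemma X_sq (τ : ℂ) (hτ : 0 < τ.im) : Xf τ ^ 2 = Af τ + 64 * Bf τ := by
  rw [Xf]
  linear_combination -Af_theta τ hτ - 4 * Bf_theta τ hτ

lemma E4_tau (τ : ℂ) (hτ : 0 < τ.im) :
    (th2 τ ^ 8 + th3 τ ^ 8 + th4 τ ^ 8) / 2 = Af τ + 256 * Bf τ := by
  have e : th2 τ ^ 8 + th3 τ ^ 8 + th4 τ ^ 8 =
    (th2 τ ^ 2) ^ 4 + (th3 τ ^ 2) ^ 4 + (th4 τ ^ 2) ^ 4 := by ring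
  rw [e, landen2 τ hτ, landen3 τ hτ, landen4 τ hτ]
  linear_combination -Af_theta τ hτ - 16 * Bf_theta τ hτ

lemma E4_two (τ : ℂ) (hτ : 0 < τ.im) :
    (th2 (2 * τ) ^ 8 + th3 (2 * τ) ^ 8 + th4 (2 * τ) ^ 8) / 2 = Af τ + 16 * Bf τ := by
  have e2 : th2 (2 * τ) = theta2 τ := by rw [th2]; congr 1; ring
  have e3 : th3 (2 * τ) = theta3 τ := by rw [th3]; congr 1; ring
  obtain ⟨-, -, h3⟩ := th_rel τ hτ
  have e4 : th4 (2 * τ) ^ 8 = (theta3 τ ^ 4 - theta2 τ ^ 4) ^ 2 := by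
    rw [h3]; ring
  rw [e2, e3, e4]
  linear_combination -Af_theta τ hτ - Bf_theta τ hτ

lemma two_hasDeriv (τ : ℂ) : HasDerivAt (fun t : ℂ => 2 * t) 2 τ := by
  simpa using (hasDerivAt_id τ).const_mul (2 : ℂ)

lemma eta2_hasDeriv (τ : ℂ) (hτ : 0 < τ.im) :
    HasDerivAt (fun t => dedekindEta (2 * t)) (cc / 12 * Ff τ * dedekindEta (2 * τ)) τ := by
  have h : HasDerivAt (fun t => dedekindEta (2 * t)) _ τ :=
    (eta_hasDeriv (2 * τ) (im_two hτ)).comp τ (two_hasDeriv τ)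
  refine h.congr_deriv ?_
  rw [Ff]; ring

lemma Ef_deriv (τ : ℂ) (hτ : 0 < τ.im) :
    HasDerivAt Ef (cc * ((Ef τ ^ 2 - (Af τ + 256 * Bf τ)) / 12)) τ := by
  refine (Ef_hasDeriv τ hτ).congr_deriv ?_
  have := ramanujan τ hτ
  rw [E4_tau τ hτ] at this
  linear_combination cc / 12 * this

lemma Ff_deriv (τ : ℂ) (hτ : 0 < τ.im) :
    HasDerivAt Ff (cc * ((Ff τ ^ 2 - (Af τ + 16 * Bf τ)) / 6)) τ := by
  have h : HasDerivAt (fun t => Ef (2 * t)) _ τ :=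
    (Ef_hasDeriv (2 * τ) (im_two hτ)).comp τ (two_hasDeriv τ)
  refine HasDerivAt.congr_deriv (f := Ff) h ?_
  have := ramanujan _ (im_two hτ)
  rw [E4_two τ hτ] at this
  rw [Ff]
  linear_combination cc / 6 * this

lemma Af_deriv (τ : ℂ) (hτ : 0 < τ.im) :
    HasDerivAt Af (cc * (2 / 3 * (Ef τ - Ff τ) * Af τ)) τ := by
  have h1 := eta_ne τ hτ
  have h2 := eta_ne _ (im_two hτ)
  have h : HasDerivAt Af _ τ := ((eta_hasDeriv τ hτ).pow 16).div ((eta2_hasDeriv τ hτ).pow 8)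
    (pow_ne_zero _ h2)
  refine h.congr_deriv ?_
  simp only [Af, Pi.pow_apply]
  generalize cc = c
  field_simp
  push_cast
  ring

lemma Bf_deriv (τ : ℂ) (hτ : 0 < τ.im) :
    HasDerivAt Bf (cc * ((4 * Ff τ - Ef τ) / 3 * Bf τ)) τ := by
  have h1 := eta_ne τ hτ
  have h2 := eta_ne _ (im_two hτ)
  have h : HasDerivAt Bf _ τ := ((eta2_hasDeriv τ hτ).pow 16).div ((eta_hasDeriv τ hτ).pow 8)
    (pow_ne_zero _ h1)
  refine h.congr_deriv ?_
  simp only [Bf, Pi.pow_apply]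
  generalize cc = c
  field_simp
  push_cast
  ring

lemma Zf_deriv (τ : ℂ) (hτ : 0 < τ.im) :
    HasDerivAt Zf (cc * ((Ef τ + 2 * Ff τ) / 3 * Zf τ)) τ := by
  have h : HasDerivAt Zf _ τ := (((eta_hasDeriv τ hτ).pow 8).const_mul 256).mul
    ((eta2_hasDeriv τ hτ).pow 8)
  refine h.congr_deriv ?_
  simp only [Zf, Pi.pow_apply]
  generalize cc = c
  push_cast
  ring

lemma dq_of {f : ℂ → ℂ} {τ v : ℂ} (h : HasDerivAt f (cc * v) τ) : dq f τ = v := by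
  rw [dq, h.deriv, inv_mul_cancel_left₀ cc_ne]

lemma E8_eq (τ : ℂ) (hτ : 0 < τ.im) : E8sig τ = (Ef τ + 2 * Ff τ) / 3 := by
  rw [E8sig, dq_of (Zf_deriv τ hτ), mul_div_cancel_right₀ _ (Zf_ne τ hτ)]

/-- The defect, which is shown to vanish. -/
def Uf (τ : ℂ) : ℂ := Af τ + 64 * Bf τ - (2 * Ff τ - Ef τ) ^ 2

lemma Uf_deriv (τ : ℂ) (hτ : 0 < τ.im) :
    HasDerivAt Uf (cc * ((Ef τ + 2 * Ff τ) / 6 * Uf τ)) τ := by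
  have h : HasDerivAt Uf _ τ := ((Af_deriv τ hτ).add ((Bf_deriv τ hτ).const_mul 64)).sub
    ((((Ff_deriv τ hτ).const_mul 2).sub (Ef_deriv τ hτ)).pow 2)
  refine h.congr_deriv ?_
  simp only [Uf, Pi.sub_apply]
  generalize cc = c
  push_cast
  ring

/-- `Uf` as a function of `q`. -/
def uu (x : ℂ) : ℂ := eulP x ^ 16 / eulP (x ^ 2) ^ 8 +
  64 * (x * eulP (x ^ 2) ^ 16 / eulP x ^ 8) - (2 * phi (x ^ 2) - phi x) ^ 2

lemma uu_zero : uu 0 = 0 := by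
  simp [uu, eulP_zero, phi_zero]
  norm_num

lemma uu_diff : DifferentiableAt ℂ uu 0 := by
  have hP := eulP_diff.differentiableAt (Metric.ball_mem_nhds 0 one_pos)
  have hphi := phi_analytic.differentiableAt
  have hsq : DifferentiableAt ℂ (fun x : ℂ => x ^ 2) 0 := by fun_prop
  have hP2 : DifferentiableAt ℂ (fun x => eulP (x ^ 2)) 0 :=
    DifferentiableAt.comp (0 : ℂ) (g := eulP) (f := fun x : ℂ => x ^ 2) (by simpa using hP) hsq
  have hphi2 : DifferentiableAt ℂ (fun x => phi (x ^ 2)) 0 :=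
    DifferentiableAt.comp (0 : ℂ) (g := phi) (f := fun x : ℂ => x ^ 2) (by simpa using hphi) hsq
  exact (((hP.pow 16).div (hP2.pow 8) (by simp [eulP_zero])).add
    (((differentiableAt_id.mul (hP2.pow 16)).div (hP.pow 8) (by simp [eulP_zero])).const_mul
      64)).sub (((hphi2.const_mul 2).sub hphi).pow 2)

lemma eta_param (τ : ℂ) : ∃ s : ℂ, s ≠ 0 ∧ s ^ 24 = qq τ ∧ dedekindEta τ = s * eulP (qq τ) ∧
    dedekindEta (2 * τ) = s ^ 2 * eulP (qq τ ^ 2) := by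
  refine ⟨cexp (Real.pi * I * τ / 12), Complex.exp_ne_zero _, ?_, eta_eulP τ, ?_⟩
  · rw [← Complex.exp_nat_mul, qq]; congr 1; push_cast; ring
  · rw [eta_eulP, qq_two, ← Complex.exp_nat_mul]; congr 2; push_cast; ring

lemma Uf_uu (τ : ℂ) (hτ : 0 < τ.im) : Uf τ = uu (qq τ) := by
  obtain ⟨s, s0, hs, h1, h2⟩ := eta_param τ
  have e1 := eulP_qq_ne τ hτ
  have e2 := eulP_qq_ne _ (im_two hτ)
  rw [qq_two] at e2
  have hA : Af τ = eulP (qq τ) ^ 16 / eulP (qq τ ^ 2) ^ 8 := by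
    rw [Af, h1, h2]
    field_simp
  have hB : Bf τ = qq τ * eulP (qq τ ^ 2) ^ 16 / eulP (qq τ) ^ 8 := by
    rw [Bf, h1, h2]
    generalize eulP (qq τ) = P at *
    generalize eulP (qq τ ^ 2) = R at *
    rw [← hs]
    field_simp
  rw [Uf, uu, hA, hB, Ff, Ef_phi τ hτ, Ef_phi _ (im_two hτ), qq_two]

lemma Zf_qq (τ : ℂ) : Zf τ = 256 * qq τ * eulP (qq τ) ^ 8 * eulP (qq τ ^ 2) ^ 8 := by
  obtain ⟨s, s0, hs, h1, h2⟩ := eta_param τ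
  rw [Zf, h1, h2, ← hs]
  ring

lemma tendsto_sq_zero : Tendsto (fun x : ℂ => x ^ 2) (𝓝 0) (𝓝 0) := by
  have : Continuous (fun x : ℂ => x ^ 2) := by fun_prop
  simpa using this.tendsto 0

lemma U_ratio_lim : Tendsto (fun τ => Uf τ ^ 2 / Zf τ) imInf (𝓝 0) := by
  have hd := uu_diff.hasDerivAt
  rw [hasDerivAt_iff_tendsto_slope] at hd
  have hq : Tendsto qq imInf (𝓝[≠] 0) :=
    tendsto_nhdsWithin_iff.mpr ⟨tendsto_qq, Eventually.of_forall fun τ => qq_ne τ⟩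
  have h1 := hd.comp hq
  have h2 : Tendsto (fun τ => uu (qq τ)) imInf (𝓝 0) := by
    have := uu_diff.continuousAt.tendsto.comp tendsto_qq
    rwa [uu_zero] at this
  have h3 := ((((tendsto_eulP.comp tendsto_qq).pow 8).mul
    ((tendsto_eulP.comp (tendsto_sq_zero.comp tendsto_qq)).pow 8)).const_mul 256).inv₀
    (by norm_num)
  have h4 := (h1.mul h2).mul h3
  rw [mul_zero, zero_mul] at h4
  refine h4.congr' ?_
  filter_upwards [ev_UH] with τ hτ
  have e1 := eulP_qq_ne τ hτ
  have e2 := eulP_qq_ne _ (im_two hτ)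
  rw [qq_two] at e2
  have e3 := qq_ne τ
  simp only [Function.comp, slope_def_field, uu_zero, sub_zero]
  rw [Uf_uu τ hτ, Zf_qq τ]
  field_simp

lemma Uf_zero (τ : ℂ) (hτ : 0 < τ.im) : Uf τ = 0 := by
  have hd (z : ℂ) (hz : 0 < z.im) : HasDerivAt (fun z => Uf z ^ 2 / Zf z) 0 z := by
    have h : HasDerivAt (fun z => Uf z ^ 2 / Zf z) _ z :=
      ((Uf_deriv z hz).pow 2).div (Zf_deriv z hz) (Zf_ne z hz)
    refine h.congr_deriv ?_
    have := Zf_ne z hz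
    simp only [Pi.pow_apply]
    generalize cc = c
    field_simp
    push_cast
    ring
  have hc : ∀ z ∈ UH, Uf z ^ 2 / Zf z = Uf τ ^ 2 / Zf τ := fun z hz =>
    UH_open.is_const_of_deriv_eq_zero UH_conn
      (fun w hw => (hd w hw).differentiableAt.differentiableWithinAt)
      (fun w hw => (hd w hw).deriv) hz hτ
  have hl : Tendsto (fun τ => Uf τ ^ 2 / Zf τ) imInf (𝓝 (Uf τ ^ 2 / Zf τ)) := by
    refine tendsto_const_nhds.congr' ?_
    filter_upwards [ev_UH] with z hz
    exact (hc z hz).symm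
  have h0 := tendsto_nhds_unique hl U_ratio_lim
  rcases div_eq_zero_iff.mp h0 with h | h
  · exact pow_eq_zero_iff (two_ne_zero) |>.mp h
  · exact absurd h (Zf_ne τ hτ)

lemma tendsto_two : Tendsto (fun τ : ℂ => 2 * τ) imInf imInf := by
  simpa using tendsto_shift 2 two_pos 0

lemma tendsto_Xf : Tendsto Xf imInf (𝓝 1) := by
  have h3 := tendsto_th3.comp tendsto_two
  have h2 : Tendsto (fun τ => th2 (2 * τ) ^ 4) imInf (𝓝 0) := by
    have := tendsto_qq.mul ((tendsto_th2_aux.comp tendsto_two).pow 4)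
    rw [zero_mul] at this
    refine this.congr fun T => ?_
    rw [th2_pow4]
    simp only [Function.comp]
    congr 3; ring
  have h := h2.add (h3.pow 4)
  rw [one_pow, zero_add] at h
  refine h.congr fun τ => ?_
  have e2 : th2 (2 * τ) = theta2 τ := by rw [th2]; congr 1; ring
  have e3 : th3 (2 * τ) = theta3 τ := by rw [th3]; congr 1; ring
  simp only [Function.comp, e2, e3, Xf]

lemma Xf_eq (τ : ℂ) (hτ : 0 < τ.im) : Xf τ = 2 * Ff τ - Ef τ := by
  have hX : DifferentiableOn ℂ Xf UH := (theta2_diff.pow 4).add (theta3_diff.pow 4)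
  have hE : DifferentiableOn ℂ Ef UH := fun z hz =>
    (Ef_deriv z hz).differentiableAt.differentiableWithinAt
  have hF : DifferentiableOn ℂ Ff UH := fun z hz =>
    (Ff_deriv z hz).differentiableAt.differentiableWithinAt
  have hF1 : Tendsto Ff imInf (𝓝 1) := tendsto_Ef.comp tendsto_two
  have hz := factor_zero (f := fun τ => Xf τ - (2 * Ff τ - Ef τ))
    (g := fun τ => Xf τ + (2 * Ff τ - Ef τ)) (hX.sub ((hF.const_mul 2).sub hE))
    (fun z hz => by
      have h1 := X_sq z hz
      have h2 := Uf_zero z hz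
      rw [Uf] at h2
      linear_combination h1 + h2) (c := 2) (by norm_num) (by
      have h := tendsto_Xf.add ((hF1.const_mul 2).sub tendsto_Ef)
      norm_num at h
      exact h)
  exact sub_eq_zero.mp (hz τ hτ)

end Final

theorem typeII_system_fricke_group_level2 (τ : ℂ) (hτ : 0 < τ.im) :
    Xf τ ^ 4 = Yf τ ^ 2 + Zf τ ∧
    E8sig τ = (1 / 3) * (2 * EisE2 (qq τ ^ 2) + EisE2 (qq τ)) ∧
    E8sig τ = 1 - 8 * ∑' n : ℕ,
      wdiv 1 2 (fun m => if m = 0 then 2 else 1) (n + 1) * qq τ ^ (n + 1) ∧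
    dq (fun t => Xf t ^ 4) τ = E8sig τ * Xf τ ^ 4 - Xf τ ^ 3 * Yf τ ∧
    dq (fun t => Yf t ^ 2) τ = E8sig τ * Yf τ ^ 2 - Xf τ ^ 3 * Yf τ ∧
    8 * dq E8sig τ = E8sig τ ^ 2 - Xf τ ^ 2 := by

  have hX := Xf_eq τ hτ
  have hX2 := X_sq τ hτ
  have hE := E8_eq τ hτ
  have hY := Yf_eq τ
  have hA := Af_deriv τ hτ
  have hB := Bf_deriv τ hτ
  have hnhds := UH_open.mem_nhds hτ
  refine ⟨?_, ?_, ?_, ?_, ?_, ?_⟩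
  · rw [hY, Zf_eq τ hτ]
    linear_combination (Xf τ ^ 2 + Af τ + 64 * Bf τ) * hX2
  · rw [hE, ← qq_two, ← Ef_EisE2 τ hτ, ← Ef_EisE2 _ (im_two hτ), Ff]
    ring
  · rw [← series_eq τ hτ, hE, ← qq_two, ← Ef_EisE2 τ hτ, ← Ef_EisE2 _ (im_two hτ), Ff]
    ring
  · have h1 : HasDerivAt (fun t => (Af t + 64 * Bf t) ^ 2) _ τ := (hA.add (hB.const_mul 64)).pow 2
    have h2 := h1.congr_of_eventuallyEq (f₁ := fun t => Xf t ^ 4) (by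
      filter_upwards [hnhds] with t ht
      rw [← X_sq t ht]; ring)
    apply dq_of
    refine h2.congr_deriv ?_
    simp only [Pi.add_apply]
    rw [show Xf τ ^ 4 = (Xf τ ^ 2) ^ 2 by ring, show Xf τ ^ 3 = Xf τ ^ 2 * Xf τ by ring, hX2, hX,
      hE, hY]
    generalize cc = c
    push_cast
    ring
  · have h1 : HasDerivAt (fun t => (Af t - 64 * Bf t) ^ 2) _ τ := (hA.sub (hB.const_mul 64)).pow 2
    have h2 := h1.congr_of_eventuallyEq (f₁ := fun t => Yf t ^ 2) (by
      filter_upwards [hnhds] with t _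
      rw [Yf_eq t])
    apply dq_of
    refine h2.congr_deriv ?_
    simp only [Pi.sub_apply]
    rw [show Xf τ ^ 3 = Xf τ ^ 2 * Xf τ by ring, hX2, hX, hE, hY]
    generalize cc = c
    push_cast
    ring
  · have h1 : HasDerivAt (fun t => (Ef t + 2 * Ff t) / 3) _ τ :=
      ((Ef_deriv τ hτ).add ((Ff_deriv τ hτ).const_mul 2)).div_const 3
    have h2 := h1.congr_of_eventuallyEq (f₁ := E8sig) (by
      filter_upwards [hnhds] with t ht
      exact E8_eq t ht)
    have h3 : dq E8sig τ = ((Ef τ ^ 2 - (Af τ + 256 * Bf τ)) / 12 +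
        (Ff τ ^ 2 - (Af τ + 16 * Bf τ)) / 3) / 3 := by
      apply dq_of
      refine h2.congr_deriv ?_
      generalize cc = c
      ring
    have h4 : (2 * Ff τ - Ef τ) ^ 2 = Af τ + 64 * Bf τ := by rw [← hX, hX2]
    rw [h3, hE, hX2]
    linear_combination (1 / 9) * h4
end
end
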